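/- arXiv:1712.04068 — 2 statements merged into one kernel-verified Lean document; each statement's English description precedes it below -/
import Mathlib

section
/- Let m, β ∈ ℂ with Re(m) > −1 and 2m ∉ ℤ, and let k ∈ ℂ with Re(k) > 0 and β/(2k) − m − 1/2 ∉ ℕ. Define the resolvent kernel R(x,y) := (1/(2k))·Γ(1/2+m−β/(2k))·ℐ_{β/(2k),m}(2k·min(x,y))·𝒦_{β/(2k),m}(2k·max(x,y)) for x, y > 0 (note that 2kx ∈ ℂ∖(−∞,0] since Re(k) > 0). Then the integral operator with kernel R is bounded on L²((0,∞)): there exists C ≥ 0 such that for every continuous compactly supported f: (0,∞) → ℂ, the function x ↦ ∫₀^∞ R(x,y)f(y) dy is square-integrable and (∫₀^∞ |∫₀^∞ R(x,y)f(y) dy|² dx)^{1/2} ≤ C·(∫₀^∞ |f(y)|² dy)^{1/2}. -/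
/-- Pochhammer symbol `(a)_k = a (a+1) ⋯ (a+k-1)`. -/
noncomputable def poch (a : ℂ) (k : ℕ) : ℂ := ∏ i ∈ Finset.range k, (a + i)

/-- Regularized confluent hypergeometric function
`₁𝐅₁(a;c;z) = Σ_{k=0}^∞ (a)_k z^k / (Γ(c+k)·k!)`. -/
noncomputable def regF1 (a c z : ℂ) : ℂ :=
  ∑' k : ℕ, poch a k * z ^ k / (Complex.Gamma (c + k) * (Nat.factorial k))

/-- The Whittaker-type function `ℐ_{β,m}(z) = z^{1/2+m} e^{-z/2} ₁𝐅₁(1/2+m-β; 1+2m; z)`. -/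
noncomputable def WI (β m z : ℂ) : ℂ :=
  z ^ ((1 : ℂ) / 2 + m) * Complex.exp (-z / 2) * regF1 (1 / 2 + m - β) (1 + 2 * m) z

/-- For `2m ∉ ℤ`, the Whittaker function
`𝒦_{β,m}(z) = −(π/sin(2πm)) (ℐ_{β,m}(z)/Γ(1/2−m−β) − ℐ_{β,−m}(z)/Γ(1/2+m−β))`. -/
noncomputable def WK (β m z : ℂ) : ℂ :=
  -((Real.pi : ℂ) / Complex.sin (2 * (Real.pi : ℂ) * m)) *
    (WI β m z / Complex.Gamma (1 / 2 - m - β) - WI β (-m) z / Complex.Gamma (1 / 2 + m - β))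

/-- The resolvent kernel
`R(x,y) = (1/(2k)) Γ(1/2+m−β/(2k)) ℐ_{β/(2k),m}(2k min(x,y)) 𝒦_{β/(2k),m}(2k max(x,y))`. -/
noncomputable def resKer (m β k : ℂ) (x y : ℝ) : ℂ :=
  (1 / (2 * k)) * Complex.Gamma (1 / 2 + m - β / (2 * k)) *
    WI (β / (2 * k)) m (2 * k * (min x y : ℝ)) *
    WK (β / (2 * k)) m (2 * k * (max x y : ℝ))

open Filter Topology MeasureTheory Asymptotics

/-- The `n`-th term of the series defining `regF1 a c z`. -/
noncomputable def regF1Term (a c z : ℂ) (n : ℕ) : ℂ :=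
  poch a n * z ^ n / (Complex.Gamma (c + n) * (Nat.factorial n))

lemma poch_succ_left (a : ℂ) (n : ℕ) : poch a (n + 1) = a * poch (a + 1) n := by
  simp only [poch, Finset.prod_range_succ']
  rw [mul_comm]
  congr 1
  · simp
  · refine Finset.prod_congr rfl fun i _ => ?_
    push_cast; ring

lemma poch_succ_right (a : ℂ) (n : ℕ) : poch a (n + 1) = poch a n * (a + n) := by
  simp [poch, Finset.prod_range_succ]

lemma regF1Term_zero (a c z : ℂ) : regF1Term a c z 0 = (Complex.Gamma c)⁻¹ := by
  simp [regF1Term, poch]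

lemma regF1Term_succ (a c z : ℂ) (n : ℕ) :
    (n + 1) * regF1Term a c z (n + 1) = z * (a * regF1Term (a + 1) (c + 1) z n) := by
  simp only [regF1Term, poch_succ_left, Nat.factorial_succ, Nat.cast_mul, pow_succ]
  have h : ((n : ℂ) + 1) ≠ 0 := Nat.cast_add_one_ne_zero n
  have h2 : (c + ((n + 1 : ℕ) : ℂ)) = c + 1 + n := by push_cast; ring
  rw [h2]
  push_cast
  have h3 : ((Nat.factorial n : ℕ) : ℂ) ≠ 0 := by exact_mod_cast Nat.factorial_ne_zero n
  by_cases h4 : Complex.Gamma (c + 1 + n) = 0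
  · simp [h4]
  · field_simp

lemma regF1Term_add_one_right (a c z : ℂ) (n : ℕ) :
    regF1Term a c z n = (c + n) * regF1Term a (c + 1) z n := by
  have h := Complex.one_div_Gamma_eq_self_mul_one_div_Gamma_add_one (c + n)
  simp only [regF1Term, div_eq_mul_inv, mul_inv]
  rw [h, show c + 1 + (n : ℂ) = c + n + 1 by ring]
  ring

lemma regF1Term_add_one_left (a c z : ℂ) (n : ℕ) :
    a * regF1Term (a + 1) c z n = (a + n) * regF1Term a c z n := by
  simp only [regF1Term]
  have := poch_succ_left a n
  rw [poch_succ_right] at this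
  linear_combination (-z ^ n / (Complex.Gamma (c + n) * (Nat.factorial n))) * this

lemma regF1Term_ratio (a c z : ℂ) (n : ℕ) :
    (c + n) * (n + 1) * regF1Term a c z (n + 1) = z * (a + n) * regF1Term a c z n := by
  have h1 := regF1Term_succ a c z n
  have h2 := regF1Term_add_one_right (a + 1) c z n
  have h3 := regF1Term_add_one_left a c z n
  linear_combination (c + n) * h1 - z * a * h2 + z * h3

lemma summable_regF1Term (a c z : ℂ) : Summable fun n => ‖regF1Term a c z n‖ := by
  suffices h : Summable (regF1Term a c z) from h.norm
  refine summable_of_ratio_norm_eventually_le (r := 1 / 2) (by norm_num) ?_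
  have hlim : Tendsto (fun n : ℕ => (n : ℝ)) atTop atTop := tendsto_natCast_atTop_atTop
  filter_upwards [hlim.eventually_ge_atTop (2 * ‖c‖ + 1), hlim.eventually_ge_atTop (‖a‖),
    hlim.eventually_ge_atTop (8 * ‖z‖)] with n h1 h2 h3
  have h := congrArg norm (regF1Term_ratio a c z n)
  simp only [norm_mul] at h
  have e1 : (n : ℝ) / 2 ≤ ‖c + n‖ := by
    have := norm_sub_le (c + n) c
    simp only [add_sub_cancel_left, Complex.norm_natCast] at this
    linarith
  have e2 : ‖(n : ℂ) + 1‖ = n + 1 := by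
    rw [← Nat.cast_add_one, Complex.norm_natCast]; push_cast; ring
  have e3 : ‖a + n‖ ≤ 2 * n := by
    have := norm_add_le a (n : ℂ)
    simp only [Complex.norm_natCast] at this
    linarith
  rw [e2] at h
  have hn : (0 : ℝ) < n := by linarith [norm_nonneg c]
  set t := ‖regF1Term a c z (n + 1)‖
  set s := ‖regF1Term a c z n‖
  have hs : 0 ≤ s := norm_nonneg _
  have ht : 0 ≤ t := norm_nonneg _
  have k1 : (n / 2 * (n + 1)) * t ≤ (n / 8 * (2 * n)) * s := by
    calc n / 2 * (n + 1) * t ≤ ‖c + n‖ * (n + 1) * t := by gcongr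
      _ = ‖z‖ * ‖a + n‖ * s := h
      _ ≤ (n / 8 * (2 * n)) * s := by gcongr; linarith
  have k2 : (n / 2 * n) * t ≤ (n / 2 * n) * (1 / 2 * s) := by
    have : 0 ≤ n / 2 * t := by positivity
    linarith
  exact le_of_mul_le_mul_left k2 (by positivity)

lemma hasSum_regF1 (a c z : ℂ) : HasSum (regF1Term a c z) (regF1 a c z) :=
  (summable_regF1Term a c z).of_norm.hasSum

lemma hasSum_nat_mul_regF1Term (a c z : ℂ) :
    HasSum (fun n : ℕ => n * regF1Term a c z n) (z * (a * regF1 (a + 1) (c + 1) z)) := by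
  rw [← hasSum_nat_add_iff' 1]
  simpa [regF1Term_succ] using
    ((hasSum_regF1 (a + 1) (c + 1) z).mul_left a).mul_left z

lemma norm_regF1Term_le {z : ℂ} {r : ℝ} (hz : ‖z‖ ≤ r) (a c : ℂ) (n : ℕ) :
    ‖regF1Term a c z n‖ ≤ ‖regF1Term a c r n‖ := by
  simp only [regF1Term, norm_div, norm_mul, norm_pow, Complex.norm_real]
  gcongr
  exact hz.trans (le_abs_self r)

lemma hasDerivAt_regF1 (a c z : ℂ) :
    HasDerivAt (regF1 a c) (a * regF1 (a + 1) (c + 1) z) z := by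
  let g' : ℕ → ℂ → ℂ := fun n y => n * (poch a n * y ^ (n - 1) / (Complex.Gamma (c + n) * (Nat.factorial n)))
  have hg'0 : ∀ y, g' 0 y = 0 := fun y => by simp [g']
  have hg's : ∀ n y, g' (n + 1) y = a * regF1Term (a + 1) (c + 1) y n := by
    intro n y
    have := regF1Term_succ a c 1 n
    simp only [regF1Term, one_pow, mul_one, one_mul, g'] at this ⊢
    push_cast at this ⊢
    linear_combination y ^ n * this
  have hsum : HasSum (fun n => g' n z) (a * regF1 (a + 1) (c + 1) z) := by
    rw [← hasSum_nat_add_iff' 1, Finset.sum_range_one, hg'0, sub_zero]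
    exact ((hasSum_regF1 (a + 1) (c + 1) z).mul_left a).congr_fun fun n => hg's n z
  set r : ℝ := ‖z‖ + 1 with hr
  let u : ℕ → ℝ := fun n => ‖g' n r‖
  have hu : Summable u := by
    rw [← summable_nat_add_iff 1]
    refine ((summable_regF1Term (a + 1) (c + 1) r).mul_left ‖a‖).congr fun n => ?_
    simp only [u, hg's, norm_mul]
  rw [← hsum.tsum_eq]
  refine hasDerivAt_tsum_of_isPreconnected (g := fun n y => regF1Term a c y n) hu
    (Metric.isOpen_ball (x := (0 : ℂ)) (ε := r)) (convex_ball _ _).isPreconnected ?_ ?_ (y₀ := z) ?_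
    (summable_regF1Term a c z).of_norm ?_
  · intro n y _
    have := ((hasDerivAt_pow n y).const_mul (poch a n)).div_const
      (Complex.Gamma (c + n) * (Nat.factorial n))
    refine HasDerivAt.congr_deriv this ?_
    simp only [g']
    ring
  · intro n y hy
    rcases n with _ | n
    · simp [u, hg'0]
    · simp only [u, hg's, norm_mul]
      gcongr
      exact norm_regF1Term_le (by simpa using (mem_ball_zero_iff.1 hy).le) _ _ _
  · simp [hr]
  · simp [hr]

lemma regF1_eq_add (a c z : ℂ) :
    regF1 a c z = c * regF1 a (c + 1) z + z * (a * regF1 (a + 1) (c + 2) z) := by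
  have h1 := ((hasSum_regF1 a (c + 1) z).mul_left c).add (hasSum_nat_mul_regF1Term a (c + 1) z)
  rw [show c + 1 + 1 = c + 2 by ring] at h1
  refine (hasSum_regF1 a c z).unique (h1.congr_fun ?_)
  intro n
  rw [regF1Term_add_one_right a c]; ring

lemma regF1_add_one_left_sub (a c z : ℂ) :
    regF1 (a + 1) c z - regF1 a c z = z * regF1 (a + 1) (c + 1) z := by
  have h0 : HasSum (fun n => regF1Term (a + 1) c z n - regF1Term a c z n)
      (z * regF1 (a + 1) (c + 1) z) := by
    rw [← hasSum_nat_add_iff' 1]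
    simp only [Finset.range_one, Finset.sum_singleton, regF1Term_zero, sub_self, sub_zero]
    refine ((hasSum_regF1 (a + 1) (c + 1) z).mul_left z).congr_fun ?_
    intro n
    have h : ((n : ℂ) + 1) ≠ 0 := Nat.cast_add_one_ne_zero n
    refine mul_left_cancel₀ h ?_
    linear_combination regF1Term_succ (a + 1) c z n - regF1Term_succ a c z n +
      z * regF1Term_add_one_left (a + 1) (c + 1) z n
  exact ((hasSum_regF1 (a + 1) c z).sub (hasSum_regF1 a c z)).unique h0

/-- Three-term recurrence in the first parameter. -/
lemma regF1_recurrence (a c z : ℂ) :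
    (a + 1) * regF1 (a + 2) c z =
      (z + 2 * a + 2 - c) * regF1 (a + 1) c z + (c - 1 - a) * regF1 a c z := by
  have h1 := regF1_eq_add a (c - 1) z
  have h2 := regF1_eq_add (a + 1) (c - 1) z
  have h3 := regF1_add_one_left_sub a (c - 1) z
  have h4 := regF1_add_one_left_sub a c z
  have h5 := regF1_add_one_left_sub (a + 1) c z
  simp only [sub_add_cancel, show c - 1 + 2 = c + 1 by ring, show a + 1 + 1 = a + 2 by ring]
    at h1 h2 h3 h4 h5
  linear_combination h1 - h2 + h3 + (a + 1) * h5 - a * h4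

lemma integrableOn_cpow_mul_exp_neg_mul_Ioi {s κ : ℂ} (hs : 0 < s.re) (hκ : 0 < κ.re) :
    IntegrableOn (fun t : ℝ => (t : ℂ) ^ (s - 1) * Complex.exp (-κ * t)) (Set.Ioi 0) := by
  have h := integrableOn_rpow_mul_exp_neg_mul_rpow (p := 1) (s := s.re - 1) (b := κ.re)
    (by linarith) one_pos hκ
  refine Integrable.mono' h ?_ ?_
  · refine (ContinuousOn.mul ?_ (by fun_prop)).aestronglyMeasurable measurableSet_Ioi
    intro t ht
    exact (Complex.continuousAt_ofReal_cpow_const _ _ (Or.inr (ne_of_gt ht))).continuousWithinAt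
  · filter_upwards [ae_restrict_mem measurableSet_Ioi] with t ht
    rw [norm_mul, Complex.norm_cpow_eq_rpow_re_of_pos ht, Complex.norm_exp]
    simp

lemma differentiableAt_integral_cpow_mul_exp_neg_mul_Ioi {s κ : ℂ} (hs : 0 < s.re)
    (hκ : 0 < κ.re) :
    DifferentiableAt ℂ
      (fun κ : ℂ => ∫ t : ℝ in Set.Ioi 0, (t : ℂ) ^ (s - 1) * Complex.exp (-κ * t)) κ := by
  have hmeas : ∀ s κ : ℂ, AEStronglyMeasurable
      (fun t : ℝ => (t : ℂ) ^ (s - 1) * Complex.exp (-κ * t)) (volume.restrict (Set.Ioi 0)) := by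
    intro s κ
    refine (ContinuousOn.mul ?_ (by fun_prop)).aestronglyMeasurable measurableSet_Ioi
    intro t ht
    exact (Complex.continuousAt_ofReal_cpow_const _ _ (Or.inr (ne_of_gt ht))).continuousWithinAt
  have hbd : Integrable (fun t : ℝ => t ^ s.re * Real.exp (-(κ.re / 2) * t ^ (1 : ℝ)))
      (volume.restrict (Set.Ioi 0)) :=
    integrableOn_rpow_mul_exp_neg_mul_rpow (by linarith) one_pos (by linarith)
  have hopen : {w : ℂ | κ.re / 2 < w.re} ∈ 𝓝 κ :=
    (isOpen_lt continuous_const Complex.continuous_re).mem_nhds (by simpa using hκ)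
  refine (hasDerivAt_integral_of_dominated_loc_of_deriv_le (𝕜 := ℂ)
    (F' := fun w (t : ℝ) => (t : ℂ) ^ (s - 1) * (Complex.exp (-w * t) * (-t)))
    hopen (Eventually.of_forall fun w => hmeas s w)
    (integrableOn_cpow_mul_exp_neg_mul_Ioi hs hκ) ?_ ?_ hbd ?_).2.differentiableAt
  · have : (fun t : ℝ => (t : ℂ) ^ (s - 1) * (Complex.exp (-κ * t) * (-t))) =
        fun t : ℝ => ((t : ℂ) ^ (s - 1) * Complex.exp (-κ * t)) * (-t) := by ext; ring
    rw [this]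
    exact (hmeas s κ).mul (by fun_prop)
  · filter_upwards [ae_restrict_mem measurableSet_Ioi] with t ht w hw
    have ht' : (0 : ℝ) < t := ht
    rw [norm_mul, norm_mul, Complex.norm_cpow_eq_rpow_re_of_pos ht, Complex.norm_exp, norm_neg,
      Complex.norm_real, Real.norm_of_nonneg ht'.le]
    have e : t ^ s.re = t ^ (s - 1).re * t := by
      rw [← Real.rpow_add_one ht'.ne']; simp
    rw [e, Real.rpow_one, mul_assoc, mul_comm t]
    have hw' : κ.re / 2 < w.re := hw
    gcongr
    simp only [neg_mul, Complex.neg_re, Complex.mul_re, Complex.ofReal_re, Complex.ofReal_im,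
      mul_zero, sub_zero]
    nlinarith
  · refine Eventually.of_forall fun t w _ => ?_
    refine HasDerivAt.const_mul _ ?_
    have := ((hasDerivAt_id w).neg.mul_const (t : ℂ)).cexp
    simpa using this

lemma integral_cpow_mul_exp_neg_mul_Ioi_of_re_pos {s κ : ℂ} (hs : 0 < s.re) (hκ : 0 < κ.re) :
    ∫ t : ℝ in Set.Ioi 0, (t : ℂ) ^ (s - 1) * Complex.exp (-κ * t) =
      κ ^ (-s) * Complex.Gamma s := by
  have hopen : IsOpen {w : ℂ | 0 < w.re} := isOpen_lt continuous_const Complex.continuous_re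
  have h1 : AnalyticOnNhd ℂ
      (fun κ : ℂ => ∫ t : ℝ in Set.Ioi 0, (t : ℂ) ^ (s - 1) * Complex.exp (-κ * t))
      {w : ℂ | 0 < w.re} :=
    DifferentiableOn.analyticOnNhd (fun w hw =>
      (differentiableAt_integral_cpow_mul_exp_neg_mul_Ioi hs hw).differentiableWithinAt) hopen
  have h2 : AnalyticOnNhd ℂ (fun κ : ℂ => κ ^ (-s) * Complex.Gamma s) {w : ℂ | 0 < w.re} :=
    DifferentiableOn.analyticOnNhd (fun w hw => by
      have hw' : w ∈ Complex.slitPlane := Or.inl hw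
      exact ((differentiableAt_id.cpow_const hw').mul_const _).differentiableWithinAt) hopen
  refine h1.eqOn_of_preconnected_of_frequently_eq h2
    (convex_halfSpace_re_gt 0).isPreconnected (z₀ := 1) (by simp) ?_ hκ
  have hreal : ∀ r : ℝ, 0 < r →
      ∫ t : ℝ in Set.Ioi 0, (t : ℂ) ^ (s - 1) * Complex.exp (-(r : ℂ) * t) =
        (r : ℂ) ^ (-s) * Complex.Gamma s := by
    intro r hr
    have h := Complex.integral_cpow_mul_exp_neg_mul_Ioi hs hr
    rw [one_div, Complex.inv_cpow _ _ (by rw [Complex.arg_ofReal_of_nonneg hr.le]; exact Real.pi_pos.ne),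
      ← Complex.cpow_neg] at h
    simpa using h
  have ht : Tendsto (fun n : ℕ => ((1 + 1 / ((n : ℝ) + 1) : ℝ) : ℂ)) atTop (𝓝[≠] 1) := by
    refine tendsto_nhdsWithin_iff.2 ⟨?_, Eventually.of_forall fun n => ?_⟩
    · have := (tendsto_one_div_add_atTop_nhds_zero_nat (𝕜 := ℝ)).const_add 1
      have h3 := (Complex.continuous_ofReal.tendsto _).comp this
      simpa [Function.comp_def] using h3
    · have : (0 : ℝ) < 1 / ((n : ℝ) + 1) := by positivity
      simp only [Set.mem_compl_iff, Set.mem_singleton_iff]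
      intro h
      have : (1 + 1 / ((n : ℝ) + 1) : ℝ) = 1 := by exact_mod_cast h
      linarith
  exact ht.frequently (Eventually.of_forall fun n => hreal _ (by positivity)).frequently

lemma Gamma_add_nat_eq_poch_mul {a : ℂ} (ha : 0 < a.re) (n : ℕ) :
    Complex.Gamma (a + n) = poch a n * Complex.Gamma a := by
  induction n with
  | zero => simp [poch]
  | succ n ih =>
    have h : a + n ≠ 0 := by
      intro h
      have := congrArg Complex.re h
      simp at this
      linarith [(Nat.cast_nonneg n : (0 : ℝ) ≤ n)]
    rw [poch_succ_right, Nat.cast_add_one, ← add_assoc, Complex.Gamma_add_one _ h, ih]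
    ring

/-- Euler's integral representation of the confluent hypergeometric function. -/
lemma integral_exp_mul_cpow_eq_regF1 {a s : ℂ} (ha : 0 < a.re) (hs : 0 < s.re) (z : ℂ) :
    ∫ t : ℝ in 0..1, (t : ℂ) ^ (a - 1) * (1 - t) ^ (s - 1) * Complex.exp (z * t) =
      Complex.Gamma a * Complex.Gamma s * regF1 a (a + s) z := by
  have hβ := (intervalIntegrable_iff_integrableOn_Ioc_of_le zero_le_one).1
    (Complex.betaIntegral_convergent ha hs)
  set b : ℝ → ℂ := fun t => (t : ℂ) ^ (a - 1) * (1 - t) ^ (s - 1) with hb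
  let F : ℕ → ℝ → ℂ := fun n t => b t * ((z * t) ^ n / (Nat.factorial n))
  have hmeas : ∀ n, AEStronglyMeasurable (F n) (volume.restrict (Set.Ioc 0 1)) := fun n =>
    hβ.aestronglyMeasurable.mul (by fun_prop)
  have hbound : ∀ n, ∀ᵐ t ∂(volume.restrict (Set.Ioc (0 : ℝ) 1)),
      ‖F n t‖ ≤ (‖z‖ ^ n / (Nat.factorial n)) * ‖b t‖ := by
    intro n
    filter_upwards [ae_restrict_mem measurableSet_Ioc] with t ht
    simp only [F, norm_mul, norm_div, norm_pow, Complex.norm_real, Complex.norm_natCast]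
    rw [mul_comm]
    gcongr
    rw [Real.norm_of_nonneg ht.1.le]
    exact mul_le_of_le_one_right (norm_nonneg _) ht.2
  have hint : ∀ n, Integrable (F n) (volume.restrict (Set.Ioc 0 1)) := fun n =>
    (hβ.norm.const_mul _).mono' (hmeas n) (hbound n)
  have hsum := hasSum_integral_of_summable_integral_norm hint (by
    refine Summable.of_nonneg_of_le (fun n => integral_nonneg fun t => norm_nonneg _)
      (fun n => integral_mono_ae (hint n).norm (hβ.norm.const_mul _) (hbound n)) ?_
    simp only [integral_const_mul]
    exact (Real.summable_pow_div_factorial ‖z‖).mul_right _)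
  have hexp : ∀ t : ℝ, ∑' n, F n t = b t * Complex.exp (z * t) := by
    intro t
    simp only [F, tsum_mul_left]
    rw [Complex.exp_eq_exp_ℂ, NormedSpace.exp_eq_tsum_div]
  simp only [hexp] at hsum
  rw [intervalIntegral.integral_of_le zero_le_one]
  refine hsum.unique ((((hasSum_regF1 a (a + s) z).mul_left
    (Complex.Gamma a * Complex.Gamma s))).congr_fun fun n => ?_)
  have hn : 0 < (a + n).re := by
    simp only [Complex.add_re, Complex.natCast_re]; positivity
  have h1 := Complex.Gamma_mul_Gamma_eq_betaIntegral hn hs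
  have h2 : Complex.Gamma (a + n + s) ≠ 0 :=
    Complex.Gamma_ne_zero_of_re_pos (by rw [Complex.add_re]; positivity)
  have h3 : ∫ t in Set.Ioc (0 : ℝ) 1, F n t =
      z ^ n / (Nat.factorial n) * Complex.betaIntegral (a + n) s := by
    rw [Complex.betaIntegral, intervalIntegral.integral_of_le zero_le_one, ← integral_const_mul]
    refine setIntegral_congr_fun measurableSet_Ioc fun t ht => ?_
    have ht' : (t : ℂ) ≠ 0 := by exact_mod_cast ht.1.ne'
    simp only [F, hb]
    rw [show a + n - 1 = a - 1 + n by ring, Complex.cpow_add _ _ ht', Complex.cpow_natCast, mul_pow]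
    ring
  rw [h3, regF1Term, show a + s + (n : ℂ) = a + n + s by ring]
  have h4 : Complex.betaIntegral (a + n) s =
      poch a n * Complex.Gamma a * Complex.Gamma s / Complex.Gamma (a + n + s) := by
    rw [eq_div_iff h2, ← Gamma_add_nat_eq_poch_mul ha, h1]; ring
  rw [h4]
  have h5 : ((Nat.factorial n : ℕ) : ℂ) ≠ 0 := by exact_mod_cast Nat.factorial_ne_zero n
  field_simp

lemma regF1_mul_exp_neg_mul_cpow_eq {a s : ℂ} (ha : 0 < a.re) (hs : 0 < s.re) (κ : ℂ) {x : ℝ}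
    (hx : 0 < x) :
    Complex.Gamma a * Complex.Gamma s * (regF1 a (a + s) (κ * x) * Complex.exp (-κ * x) * x ^ s) =
      ∫ r : ℝ in 0..x, (r : ℂ) ^ (s - 1) * Complex.exp (-κ * r) * (1 - r / x) ^ (a - 1) := by
  have hx' : (x : ℂ) ≠ 0 := by exact_mod_cast hx.ne'
  have h1 := integral_exp_mul_cpow_eq_regF1 ha hs (κ * x)
  have h2 := intervalIntegral.integral_comp_sub_left (a := 0) (b := 1)
    (fun t : ℝ => (t : ℂ) ^ (a - 1) * (1 - t) ^ (s - 1) * Complex.exp (κ * x * t)) 1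
  have h3 := intervalIntegral.integral_comp_div (a := 0) (b := x) (fun t : ℝ =>
    ((1 - t : ℝ) : ℂ) ^ (a - 1) * (1 - (1 - t : ℝ)) ^ (s - 1) * Complex.exp (κ * x * (1 - t : ℝ)))
    hx.ne'
  simp only [sub_self, sub_zero] at h2
  rw [zero_div, div_self hx.ne', h2, h1] at h3
  have h4 : ∀ r ∈ Set.uIoc 0 x, (r : ℂ) ^ (s - 1) * Complex.exp (-κ * r) * (1 - r / x) ^ (a - 1) =
      (x ^ (s - 1) * Complex.exp (-κ * x)) * (((1 - r / x : ℝ) : ℂ) ^ (a - 1) *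
        (1 - (1 - r / x : ℝ)) ^ (s - 1) * Complex.exp (κ * x * (1 - r / x : ℝ))) := by
    intro r hr
    rw [Set.uIoc_of_le hx.le] at hr
    have e1 : (r : ℂ) ^ (s - 1) = x ^ (s - 1) * ((1 : ℂ) - (1 - r / x : ℝ)) ^ (s - 1) := by
      have : (1 : ℂ) - (1 - r / x : ℝ) = ((r / x : ℝ) : ℂ) := by push_cast; ring
      rw [this, ← Complex.mul_cpow_ofReal_nonneg hx.le (div_nonneg hr.1.le hx.le)]
      congr 1
      push_cast; field_simp
    have e2 : Complex.exp (-κ * r) =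
        Complex.exp (-κ * x) * Complex.exp (κ * x * (1 - r / x : ℝ)) := by
      rw [← Complex.exp_add]; congr 1; push_cast; field_simp; ring
    rw [e1, e2]
    push_cast
    ring
  rw [intervalIntegral.integral_congr_ae (Eventually.of_forall h4), intervalIntegral.integral_const_mul,
    h3, Complex.real_smul, Complex.cpow_sub _ _ hx', Complex.cpow_one]
  field_simp

lemma tendsto_regF1_of_one_le_re {a c κ : ℂ} (ha : 1 ≤ a.re) (hs : 0 < (c - a).re)
    (hκ : 0 < κ.re) :
    Tendsto (fun x : ℝ => regF1 a c (κ * x) * Complex.exp (-κ * x) * (x : ℂ) ^ (c - a)) atTop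
      (𝓝 (κ ^ (a - c) / Complex.Gamma a)) := by
  set s := c - a with hsdef
  have ha0 : 0 < a.re := by linarith
  have hΓa : Complex.Gamma a ≠ 0 := Complex.Gamma_ne_zero_of_re_pos ha0
  have hΓs : Complex.Gamma s ≠ 0 := Complex.Gamma_ne_zero_of_re_pos hs
  have hint := integrableOn_cpow_mul_exp_neg_mul_Ioi hs hκ
  have key : Tendsto (fun x : ℝ => ∫ r in Set.Ioi (0 : ℝ), (Set.Ioc 0 x).indicator
      (fun r : ℝ => (r : ℂ) ^ (s - 1) * Complex.exp (-κ * r) * (1 - r / x) ^ (a - 1)) r) atTop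
      (𝓝 (∫ r : ℝ in Set.Ioi 0, (r : ℂ) ^ (s - 1) * Complex.exp (-κ * r))) := by
    refine tendsto_integral_filter_of_dominated_convergence
      (fun r : ℝ => ‖(r : ℂ) ^ (s - 1) * Complex.exp (-κ * r)‖) ?_ ?_ hint.norm ?_
    · refine Eventually.of_forall fun x => AEStronglyMeasurable.indicator ?_ measurableSet_Ioc
      refine hint.aestronglyMeasurable.mul (Measurable.aestronglyMeasurable ?_)
      fun_prop
    · refine Eventually.of_forall fun x => Eventually.of_forall fun r => ?_
      by_cases hr : r ∈ Set.Ioc 0 x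
      · rw [Set.indicator_of_mem hr, norm_mul]
        refine mul_le_of_le_one_right (norm_nonneg _) ?_
        have hx : 0 < x := hr.1.trans_le hr.2
        have h0 : 0 ≤ 1 - r / x := by
          rw [sub_nonneg, div_le_one hx]; exact hr.2
        have h1 : 1 - r / x ≤ 1 := by
          have := div_nonneg hr.1.le hx.le
          linarith
        have : ((1 : ℂ) - r / x) = ((1 - r / x : ℝ) : ℂ) := by push_cast; ring
        rw [this]
        refine (Complex.norm_cpow_le _ _).trans ?_
        rw [Complex.arg_ofReal_of_nonneg h0, Complex.norm_real, Real.norm_of_nonneg h0]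
        simp only [zero_mul, Real.exp_zero, div_one]
        exact Real.rpow_le_one h0 h1 (by simpa using ha)
      · rw [Set.indicator_of_notMem hr, norm_zero]
        exact norm_nonneg _
    · filter_upwards [ae_restrict_mem measurableSet_Ioi] with r hr
      have h0 : Tendsto (fun x : ℝ => (1 : ℂ) - r / x) atTop (𝓝 1) := by
        have := ((tendsto_const_nhds (x := r)).div_atTop tendsto_id).const_sub 1
        have h3 := (Complex.continuous_ofReal.tendsto _).comp this
        simpa [Function.comp_def] using h3
      have h1 : Tendsto (fun x : ℝ => (r : ℂ) ^ (s - 1) * Complex.exp (-κ * r) *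
          ((1 : ℂ) - r / x) ^ (a - 1)) atTop (𝓝 ((r : ℂ) ^ (s - 1) * Complex.exp (-κ * r))) := by
        have h4 : Tendsto (fun x : ℝ => ((1 : ℂ) - r / x) ^ (a - 1)) atTop (𝓝 (1 ^ (a - 1))) :=
          h0.cpow tendsto_const_nhds (by simp)
        simpa using h4.const_mul ((r : ℂ) ^ (s - 1) * Complex.exp (-κ * r))
      refine h1.congr' ?_
      filter_upwards [eventually_ge_atTop r] with x hx
      rw [Set.indicator_of_mem (show r ∈ Set.Ioc 0 x from ⟨hr, hx⟩)]
  rw [integral_cpow_mul_exp_neg_mul_Ioi_of_re_pos hs hκ] at key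
  have key2 := key.const_mul ((Complex.Gamma a)⁻¹ * (Complex.Gamma s)⁻¹)
  have e : (Complex.Gamma a)⁻¹ * (Complex.Gamma s)⁻¹ * (κ ^ (-s) * Complex.Gamma s) =
      κ ^ (a - c) / Complex.Gamma a := by
    rw [hsdef] at hΓs ⊢
    rw [neg_sub]; field_simp
  rw [e] at key2
  refine key2.congr' ?_
  filter_upwards [eventually_gt_atTop 0] with x hx
  have h := regF1_mul_exp_neg_mul_cpow_eq ha0 hs κ hx
  rw [show a + s = c by rw [hsdef]; ring, intervalIntegral.integral_of_le hx.le] at h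
  rw [integral_indicator measurableSet_Ioc, Measure.restrict_restrict measurableSet_Ioc,
    Set.inter_eq_left.2 Set.Ioc_subset_Ioi_self, ← h]
  field_simp

lemma hasDerivAt_exp_mul_rpow (τ σ : ℝ) {x : ℝ} (hx : 0 < x) :
    HasDerivAt (fun x => Real.exp (τ * x) * x ^ σ)
      ((τ + σ / x) * (Real.exp (τ * x) * x ^ σ)) x := by
  have h1 := ((hasDerivAt_id x).const_mul τ).exp
  have h2 := Real.hasDerivAt_rpow_const (p := σ) (Or.inl hx.ne')
  refine (h1.mul h2).congr_deriv ?_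
  rw [Real.rpow_sub_one hx.ne']
  simp only [id]
  field_simp

lemma eventually_half_le_add_div (σ : ℝ) {δ : ℝ} (hδ : 0 < δ) :
    ∀ᶠ x : ℝ in atTop, δ / 2 ≤ δ + σ / x := by
  have h : Tendsto (fun x : ℝ => δ + σ / x) atTop (𝓝 (δ + 0)) :=
    (tendsto_const_nhds.div_atTop tendsto_id).const_add δ
  rw [add_zero] at h
  exact (h.eventually_const_lt (show δ / 2 < δ by linarith)).mono fun x hx => hx.le

/-- Integrating an `o` estimate against an exponentially growing function. -/
lemma isLittleO_of_deriv_isLittleO_exp {F F' : ℝ → ℂ} {δ σ : ℝ} (hδ : 0 < δ)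
    (hF : ∀ x > 0, HasDerivAt F (F' x) x)
    (hF' : F' =o[atTop] fun x : ℝ => Real.exp (δ * x) * x ^ σ) :
    F =o[atTop] fun x : ℝ => Real.exp (δ * x) * x ^ σ := by
  rw [isLittleO_iff]
  intro ε hε
  obtain ⟨X, hX⟩ := eventually_atTop.1 ((eventually_gt_atTop (0 : ℝ)).and
    ((eventually_half_le_add_div σ hδ).and
      (isLittleO_iff.1 hF' (show 0 < ε * δ / 4 by positivity))))
  have hX0 : 0 < X := (hX X le_rfl).1
  set g : ℝ → ℝ := fun x => Real.exp (δ * x) * x ^ σ with hg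
  have hgpos : ∀ x > 0, 0 < g x := fun x hx => by positivity
  have hbound : ∀ x ≥ X, ‖F x‖ ≤ ‖F X‖ + ε / 2 * (g x - g X) := by
    intro x hx
    have hgd : ∀ y ∈ Set.Icc X x, HasDerivAt (fun y => ‖F X‖ + ε / 2 * (g y - g X))
        (ε / 2 * ((δ + σ / y) * g y)) y := fun y hy =>
      (((hasDerivAt_exp_mul_rpow δ σ (hX0.trans_le hy.1)).sub_const _).const_mul _).const_add _
    refine image_norm_le_of_norm_deriv_right_le_deriv_boundary' (f' := F')
      (B' := fun y => ε / 2 * ((δ + σ / y) * g y))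
      (fun y hy => (hF y (hX0.trans_le hy.1)).continuousAt.continuousWithinAt)
      (fun y hy => (hF y (hX0.trans_le hy.1)).hasDerivWithinAt) (by simp)
      (fun y hy => (hgd y hy).continuousAt.continuousWithinAt)
      (fun y hy => (hgd y ⟨hy.1, hy.2.le⟩).hasDerivWithinAt) ?_ ⟨hx, le_rfl⟩
    intro y hy
    obtain ⟨h1, h2, h3⟩ := hX y hy.1
    have hgy := hgpos y h1
    rw [Real.norm_of_nonneg hgy.le] at h3
    have := mul_le_mul_of_nonneg_right h2 hgy.le
    nlinarith
  have hone : (fun _ : ℝ => ‖F X‖) =o[atTop] g := by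
    have h := (isLittleO_rpow_exp_pos_mul_atTop (-σ) hδ).mul_isBigO
      (isBigO_refl (fun x : ℝ => x ^ σ) atTop)
    have h2 : (fun x : ℝ => x ^ (-σ) * x ^ σ) =ᶠ[atTop] fun _ => 1 := by
      filter_upwards [eventually_gt_atTop 0] with x hx
      rw [← Real.rpow_add hx]; simp
    have h3 := (h2.symm.trans_isLittleO h).const_mul_left ‖F X‖
    simpa using h3
  filter_upwards [isLittleO_iff.1 hone (show 0 < ε / 2 by positivity), eventually_ge_atTop X]
    with x h1 h2
  have hgx := hgpos x (hX0.trans_le h2)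
  have hgX := hgpos X hX0
  rw [Real.norm_of_nonneg hgx.le] at h1 ⊢
  rw [norm_norm] at h1
  have := hbound x h2
  nlinarith

/-- Integrating from infinity an `O` estimate against an exponentially decaying function. -/
lemma isBigO_of_deriv_isBigO_exp_neg {F F' : ℝ → ℂ} {δ σ : ℝ} (hδ : 0 < δ)
    (hF : ∀ᶠ x in atTop, HasDerivAt F (F' x) x) (hlim : Tendsto F atTop (𝓝 0))
    (hF' : F' =O[atTop] fun x : ℝ => Real.exp (-δ * x) * x ^ σ) :
    F =O[atTop] fun x : ℝ => Real.exp (-δ * x) * x ^ σ := by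
  obtain ⟨C, hC0, hC⟩ := hF'.exists_pos
  obtain ⟨X, hX⟩ := eventually_atTop.1 ((eventually_gt_atTop (0 : ℝ)).and
    ((eventually_half_le_add_div (-σ) hδ).and (hC.bound.and hF)))
  set g : ℝ → ℝ := fun x => Real.exp (-δ * x) * x ^ σ with hg
  have hgpos : ∀ x > 0, 0 < g x := fun x hx => by positivity
  refine IsBigO.of_bound (2 * C / δ) ?_
  filter_upwards [eventually_ge_atTop X] with x hx
  have hx0 : 0 < x := (hX x hx).1
  rw [Real.norm_of_nonneg (hgpos x hx0).le]
  have hbound : ∀ y ≥ x, ‖F y - F x‖ ≤ 2 * C / δ * (g x - g y) := by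
    intro y hy
    have hgd : ∀ t ∈ Set.Icc x y, HasDerivAt (fun t => 2 * C / δ * (g x - g t))
        (2 * C / δ * (-((-δ + σ / t) * g t))) t := fun t ht =>
      ((hasDerivAt_exp_mul_rpow (-δ) σ (hx0.trans_le ht.1)).const_sub _).const_mul _
    have hFd : ∀ t ∈ Set.Icc x y, HasDerivAt (fun t => F t - F x) (F' t) t := fun t ht =>
      (hX t (hx.trans ht.1)).2.2.2.sub_const _
    refine image_norm_le_of_norm_deriv_right_le_deriv_boundary'
      (f := fun t => F t - F x) (f' := F')
      (B := fun t => 2 * C / δ * (g x - g t))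
      (B' := fun t => 2 * C / δ * (-((-δ + σ / t) * g t)))
      (fun t ht => (hFd t ht).continuousAt.continuousWithinAt)
      (fun t ht => (hFd t ⟨ht.1, ht.2.le⟩).hasDerivWithinAt) (by simp)
      (fun t ht => (hgd t ht).continuousAt.continuousWithinAt)
      (fun t ht => (hgd t ⟨ht.1, ht.2.le⟩).hasDerivWithinAt) ?_ ⟨hy, le_rfl⟩
    intro t ht
    obtain ⟨h1, h2, h3, -⟩ := hX t (hx.trans ht.1)
    have hgt := hgpos t h1
    rw [Real.norm_of_nonneg hgt.le] at h3
    have h4 := mul_le_mul_of_nonneg_right h2 hgt.le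
    have h5 : C * g t = 2 * C / δ * (δ / 2 * g t) := by field_simp
    rw [h5] at h3
    refine h3.trans (mul_le_mul_of_nonneg_left (h4.trans (le_of_eq ?_)) (by positivity))
    ring
  have h1 : Tendsto (fun y => ‖F y - F x‖) atTop (𝓝 ‖0 - F x‖) := (hlim.sub_const _).norm
  rw [zero_sub, norm_neg] at h1
  refine le_of_tendsto h1 ?_
  filter_upwards [eventually_ge_atTop x] with y hy
  refine (hbound y hy).trans (mul_le_mul_of_nonneg_left ?_ (by positivity))
  linarith [hgpos y (hx0.trans_le hy)]

lemma norm_exp_mul_cpow (κ s : ℂ) {x : ℝ} (hx : 0 < x) :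
    ‖Complex.exp (κ * x) * (x : ℂ) ^ s‖ = Real.exp (κ.re * x) * x ^ s.re := by
  rw [norm_mul, Complex.norm_cpow_eq_rpow_re_of_pos hx, Complex.norm_exp]
  simp

lemma exp_mul_cpow_mul_cancel (κ s : ℂ) {x : ℝ} (hx : 0 < x) :
    Complex.exp (κ * x) * (x : ℂ) ^ s * (Complex.exp (-κ * x) * (x : ℂ) ^ (-s)) = 1 := by
  have hx' : (x : ℂ) ≠ 0 := by exact_mod_cast hx.ne'
  rw [mul_mul_mul_comm, ← Complex.exp_add, ← Complex.cpow_add _ _ hx']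
  simp

lemma tendsto_ofReal_inv_atTop : Tendsto (fun x : ℝ => (x : ℂ)⁻¹) atTop (𝓝 0) := by
  have h := (Complex.continuous_ofReal.tendsto 0).comp tendsto_inv_atTop_zero
  simpa [Function.comp_def] using h

lemma tendsto_of_deriv_tendsto_exp {F F' : ℝ → ℂ} {κ s ℓ : ℂ} (hκ : 0 < κ.re)
    (hF : ∀ x > 0, HasDerivAt F (F' x) x)
    (hF' : Tendsto (fun x : ℝ => F' x * (Complex.exp (-κ * x) * (x : ℂ) ^ (-s))) atTop (𝓝 ℓ)) :
    Tendsto (fun x : ℝ => F x * (Complex.exp (-κ * x) * (x : ℂ) ^ (-s))) atTop (𝓝 (ℓ / κ)) := by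
  have hκ0 : κ ≠ 0 := by rintro rfl; simp at hκ
  set G : ℝ → ℂ := fun x => Complex.exp (κ * x) * (x : ℂ) ^ s with hG
  have hGd : ∀ x > 0, HasDerivAt G ((κ + s / x) * G x) x := by
    intro x hx
    have hx' : (x : ℂ) ∈ Complex.slitPlane := Or.inl (by simpa using hx)
    have hx0 : (x : ℂ) ≠ 0 := by exact_mod_cast hx.ne'
    have h1 : HasDerivAt (fun z : ℂ => Complex.exp (κ * z) * z ^ s)
        ((κ + s / x) * (Complex.exp (κ * x) * (x : ℂ) ^ s)) x := by
      refine ((((hasDerivAt_id (x : ℂ)).const_mul κ).cexp).mul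
        ((hasDerivAt_id (x : ℂ)).cpow_const hx')).congr_deriv ?_
      simp only [id]
      rw [Complex.cpow_sub _ _ hx0, Complex.cpow_one]
      field_simp
    exact h1.comp_ofReal
  have hGn : ∀ x > 0, ‖G x‖ = Real.exp (κ.re * x) * x ^ s.re := fun x hx => norm_exp_mul_cpow κ s hx
  have hH : (fun x => F x - ℓ / κ * G x) =o[atTop] fun x : ℝ => Real.exp (κ.re * x) * x ^ s.re := by
    refine isLittleO_of_deriv_isLittleO_exp (F' := fun x => F' x - ℓ / κ * ((κ + s / x) * G x)) hκ
      (fun x hx => (hF x hx).sub ((hGd x hx).const_mul _)) ?_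
    have h1 : Tendsto (fun x : ℝ => F' x * (Complex.exp (-κ * x) * (x : ℂ) ^ (-s)) -
        ℓ / κ * (κ + s / x)) atTop (𝓝 0) := by
      have h2 : Tendsto (fun x : ℝ => s / (x : ℂ)) atTop (𝓝 0) := by
        simpa [div_eq_mul_inv] using tendsto_ofReal_inv_atTop.const_mul s
      have h3 := hF'.sub ((h2.const_add κ).const_mul (ℓ / κ))
      simpa [div_mul_cancel₀ _ hκ0] using h3
    have h2 := ((isLittleO_one_iff ℝ).2 h1).mul_isBigO (isBigO_refl G atTop).norm_right
    have h3 : (fun x : ℝ => (1 : ℝ) * ‖G x‖) =ᶠ[atTop] fun x => Real.exp (κ.re * x) * x ^ s.re := by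
      filter_upwards [eventually_gt_atTop 0] with x hx
      rw [hGn x hx, one_mul]
    refine (h2.congr' ?_ EventuallyEq.rfl).trans_eventuallyEq h3
    filter_upwards [eventually_gt_atTop 0] with x hx
    linear_combination F' x * exp_mul_cpow_mul_cancel κ s hx
  have h4 : Tendsto (fun x : ℝ => (F x - ℓ / κ * G x) * (Complex.exp (-κ * x) * (x : ℂ) ^ (-s)))
      atTop (𝓝 0) := by
    rw [← isLittleO_one_iff ℝ]
    have h5 := hH.mul_isBigO (isBigO_refl
      (fun x : ℝ => Complex.exp (-κ * x) * (x : ℂ) ^ (-s)) atTop).norm_right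
    refine h5.congr' EventuallyEq.rfl ?_
    filter_upwards [eventually_gt_atTop 0] with x hx
    rw [← hGn x hx, ← norm_mul, exp_mul_cpow_mul_cancel κ s hx, norm_one]
  have h6 := h4.add_const (ℓ / κ)
  rw [zero_add] at h6
  refine h6.congr' ?_
  filter_upwards [eventually_gt_atTop 0] with x hx
  linear_combination (-ℓ / κ) * exp_mul_cpow_mul_cancel κ s hx

lemma mul_ofReal_cpow {κ : ℂ} (hκ : κ ≠ 0) {x : ℝ} (hx : 0 < x) (s : ℂ) :
    (κ * x) ^ s = κ ^ s * (x : ℂ) ^ s := by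
  have hx0 : (x : ℂ) ≠ 0 := by exact_mod_cast hx.ne'
  rw [mul_comm κ, Complex.cpow_def_of_ne_zero (mul_ne_zero hx0 hκ), Complex.log_ofReal_mul hx hκ,
    Complex.cpow_def_of_ne_zero hκ, Complex.cpow_def_of_ne_zero hx0, ← Complex.exp_add,
    Complex.ofReal_log hx.le]
  congr 1
  ring

lemma hasDerivAt_regF1_mul_ofReal (a c κ : ℂ) (x : ℝ) :
    HasDerivAt (fun x : ℝ => regF1 a c (κ * x)) (κ * (a * regF1 (a + 1) (c + 1) (κ * x))) x := by
  have h : HasDerivAt (fun z : ℂ => regF1 a c (κ * z))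
      (a * regF1 (a + 1) (c + 1) (κ * x) * (κ * 1)) (x : ℂ) :=
    (hasDerivAt_regF1 a c (κ * x)).comp (x : ℂ) ((hasDerivAt_id (x : ℂ)).const_mul κ)
  exact h.comp_ofReal.congr_deriv (by ring)

lemma tendsto_regF1_of_re_lt {κ : ℂ} (hκ : 0 < κ.re) (n : ℕ) {a c : ℂ} (ha : 1 - (n : ℝ) ≤ a.re)
    (hs : 0 < (c - a).re) :
    Tendsto (fun x : ℝ => regF1 a c (κ * x) * Complex.exp (-κ * x) * (x : ℂ) ^ (c - a)) atTop
      (𝓝 (κ ^ (a - c) / Complex.Gamma a)) := by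
  induction n generalizing a c with
  | zero => exact tendsto_regF1_of_one_le_re (by simpa using ha) hs hκ
  | succ n ih =>
    have hκ0 : κ ≠ 0 := by rintro rfl; simp at hκ
    have h := ih (a := a + 1) (c := c + 1) (by
      push_cast at ha; simp only [Complex.add_re, Complex.one_re]; linarith) (by simpa using hs)
    have h2 := h.const_mul (κ * a)
    have hF := tendsto_of_deriv_tendsto_exp (s := a - c) (ℓ := κ * a * (κ ^ (a - c) / Complex.Gamma (a + 1)))
      hκ (fun x _ => hasDerivAt_regF1_mul_ofReal a c κ x) (by
        refine h2.congr' (Eventually.of_forall fun x => ?_) |>.trans_eq ?_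
        · rw [neg_sub, add_sub_add_right_eq_sub]; ring
        · rw [add_sub_add_right_eq_sub])
    have e : κ * a * (κ ^ (a - c) / Complex.Gamma (a + 1)) / κ = κ ^ (a - c) / Complex.Gamma a := by
      rw [div_eq_mul_inv _ (Complex.Gamma a),
        Complex.one_div_Gamma_eq_self_mul_one_div_Gamma_add_one a]
      field_simp
    rw [e, neg_sub] at hF
    simpa only [mul_assoc] using hF

/-- Leading asymptotics of the confluent hypergeometric function along a ray in the right
half-plane. -/
lemma tendsto_regF1 {κ : ℂ} (hκ : 0 < κ.re) (a c : ℂ) :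
    Tendsto (fun x : ℝ => regF1 a c (κ * x) * Complex.exp (-κ * x) * (x : ℂ) ^ (c - a)) atTop
      (𝓝 (κ ^ (a - c) / Complex.Gamma a)) := by
  have hκ0 : κ ≠ 0 := by rintro rfl; simp at hκ
  suffices H : ∀ n : ℕ, ∀ a c : ℂ, -(n : ℝ) < (c - a).re →
      Tendsto (fun x : ℝ => regF1 a c (κ * x) * Complex.exp (-κ * x) * (x : ℂ) ^ (c - a)) atTop
        (𝓝 (κ ^ (a - c) / Complex.Gamma a)) by
    obtain ⟨n, hn⟩ := exists_nat_gt (-(c - a).re)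
    exact H n a c (by linarith)
  intro n
  induction n with
  | zero =>
    intro a c hac
    obtain ⟨n, hn⟩ := exists_nat_ge (1 - a.re)
    exact tendsto_regF1_of_re_lt hκ n (by linarith) (by simpa using hac)
  | succ n ih =>
    intro a c hac
    push_cast at hac
    simp only [Complex.sub_re] at hac
    have h1 := ih a (c + 1) (by simp only [Complex.sub_re, Complex.add_re, Complex.one_re]; linarith)
    have h2 := ih (a + 1) (c + 2) (by
      simp only [Complex.sub_re, Complex.add_re, Complex.one_re, Complex.re_ofNat]; linarith)
    have h3 := ((h1.mul tendsto_ofReal_inv_atTop).const_mul c).add (h2.const_mul (κ * a))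
    have e : c * (κ ^ (a - (c + 1)) / Complex.Gamma a * 0) +
        κ * a * (κ ^ (a + 1 - (c + 2)) / Complex.Gamma (a + 1)) =
        κ ^ (a - c) / Complex.Gamma a := by
      rw [div_eq_mul_inv _ (Complex.Gamma a), div_eq_mul_inv _ (Complex.Gamma a),
        Complex.one_div_Gamma_eq_self_mul_one_div_Gamma_add_one a,
        mul_zero, mul_zero, zero_add, show a - c = a + 1 - (c + 2) + 1 by ring,
        Complex.cpow_add (a + 1 - (c + 2)) _ hκ0, Complex.cpow_one]
      ring
    rw [e] at h3
    refine h3.congr' ?_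
    filter_upwards [eventually_gt_atTop 0] with x hx
    have hx0 : (x : ℂ) ≠ 0 := by exact_mod_cast hx.ne'
    rw [regF1_eq_add a c, show c + 2 - (a + 1) = c - a + 1 by ring,
      show c + 1 - a = c - a + 1 by ring, Complex.cpow_add _ _ hx0, Complex.cpow_one]
    field_simp

lemma mul_deriv_regF1 (a c z : ℂ) :
    z * (a * regF1 (a + 1) (c + 1) z) = a * (regF1 (a + 1) c z - regF1 a c z) := by
  rw [regF1_add_one_left_sub]; ring

lemma mul_deriv_regF1_add_one (a c z : ℂ) :
    z * ((a + 1) * regF1 (a + 1 + 1) (c + 1) z) =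
      (z + a + 1 - c) * regF1 (a + 1) c z + (c - a - 1) * regF1 a c z := by
  have h1 := regF1_add_one_left_sub (a + 1) c z
  have h2 := regF1_recurrence a c z
  rw [show a + 2 = a + 1 + 1 by ring] at h2
  linear_combination -(a + 1) * h1 + h2

/-- The Wronskian of the two standard solutions of Kummer's equation. -/
lemma exists_regF1_wronskian (a c κ : ℂ) : ∃ D : ℂ, ∀ x : ℝ, 0 < x →
    (a - c + 1) * (regF1 a c (κ * x) * regF1 (a - c + 1 + 1) (2 - c) (κ * x)) -
      a * (regF1 (a + 1) c (κ * x) * regF1 (a - c + 1) (2 - c) (κ * x)) =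
    D * Complex.exp (κ * x) := by
  set W : ℝ → ℂ := fun x => ((a - c + 1) * (regF1 a c (κ * x) * regF1 (a - c + 1 + 1) (2 - c) (κ * x)) -
      a * (regF1 (a + 1) c (κ * x) * regF1 (a - c + 1) (2 - c) (κ * x))) *
      Complex.exp (-κ * x) with hW
  have hderiv : ∀ x ∈ Set.Ioi (0 : ℝ), HasDerivAt W 0 x := by
    intro x hx
    have hx0 : (x : ℂ) ≠ 0 := by exact_mod_cast (ne_of_gt hx)
    have he : HasDerivAt (fun x : ℝ => Complex.exp (-κ * x)) (Complex.exp (-κ * x) * (-κ)) x := by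
      have : HasDerivAt (fun z : ℂ => Complex.exp (-κ * z)) (Complex.exp (-κ * x) * (-κ * 1)) (x : ℂ) :=
        ((hasDerivAt_id (x : ℂ)).const_mul (-κ)).cexp
      simpa using this.comp_ofReal
    have h := (((((hasDerivAt_regF1_mul_ofReal a c κ x).mul
      (hasDerivAt_regF1_mul_ofReal (a - c + 1 + 1) (2 - c) κ x)).const_mul (a - c + 1)).sub
      (((hasDerivAt_regF1_mul_ofReal (a + 1) c κ x).mul
      (hasDerivAt_regF1_mul_ofReal (a - c + 1) (2 - c) κ x)).const_mul a))).mul he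
    refine h.congr_deriv (mul_left_cancel₀ hx0 ?_)
    clear h he hW
    clear W
    have k1 := mul_deriv_regF1 a c (κ * x)
    have k2 := mul_deriv_regF1_add_one a c (κ * x)
    have k3 := mul_deriv_regF1 (a - c + 1) (2 - c) (κ * x)
    have k4 := mul_deriv_regF1_add_one (a - c + 1) (2 - c) (κ * x)
    simp only [Pi.mul_apply, Pi.sub_apply, mul_zero]
    generalize regF1 a c (κ * x) = f at *
    generalize regF1 (a + 1) c (κ * x) = f1 at *
    generalize regF1 (a - c + 1) (2 - c) (κ * x) = g at *
    generalize regF1 (a - c + 1 + 1) (2 - c) (κ * x) = g1 at *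
    generalize Complex.exp (-κ * x) = e at *
    linear_combination e * ((a - c + 1) * (g1 * k1 + f * k4) - a * (g * k2 + f1 * k3))
  refine ⟨W 1, fun x hx => ?_⟩
  have hconst := isOpen_Ioi.is_const_of_deriv_eq_zero isPreconnected_Ioi
    (fun x hx => (hderiv x hx).differentiableAt.differentiableWithinAt)
    (fun x hx => (hderiv x hx).deriv) (Set.mem_Ioi.2 hx) (Set.mem_Ioi.2 (one_pos (α := ℝ)))
  rw [← hconst, hW, mul_assoc, ← Complex.exp_add]
  simp

/-- The recessive combination of the two standard solutions of Kummer's equation. -/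
lemma isBigO_regF1_recessive {a c κ : ℂ} (hκ : 0 < κ.re) (ha : ∀ n : ℕ, a ≠ -n) :
    (fun x : ℝ => regF1 a c (κ * x) / Complex.Gamma (a - c + 1) -
      (κ * x) ^ (1 - c) * regF1 (a - c + 1) (2 - c) (κ * x) / Complex.Gamma a)
      =O[atTop] fun x : ℝ => x ^ (-a.re) := by
  have hκ0 : κ ≠ 0 := by rintro rfl; simp at hκ
  have hΓ : Complex.Gamma a ≠ 0 := Complex.Gamma_ne_zero ha
  set f : ℝ → ℂ := fun x => regF1 a c (κ * x) with hf
  set h : ℝ → ℂ := fun x => regF1 (a - c + 1) (2 - c) (κ * x) with hh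
  have lf : Tendsto (fun x : ℝ => f x * Complex.exp (-κ * x) * (x : ℂ) ^ (c - a)) atTop
      (𝓝 (κ ^ (a - c) / Complex.Gamma a)) := tendsto_regF1 hκ a c
  have lh : Tendsto (fun x : ℝ => h x * Complex.exp (-κ * x) * (x : ℂ) ^ (1 - a)) atTop
      (𝓝 (κ ^ (a - 1) / Complex.Gamma (a - c + 1))) := by
    have := tendsto_regF1 hκ (a - c + 1) (2 - c)
    rwa [show 2 - c - (a - c + 1) = 1 - a by ring, show a - c + 1 - (2 - c) = a - 1 by ring] at this
  have hne : κ ^ (a - c) / Complex.Gamma a ≠ 0 := div_ne_zero (by simp [Complex.cpow_eq_zero_iff, hκ0]) hΓ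
  have hf0 : ∀ᶠ x in atTop, f x ≠ 0 := (lf.eventually_ne hne).mono fun x hx h0 => hx (by simp [h0])
  obtain ⟨D, hD⟩ := exists_regF1_wronskian a c κ
  set q : ℂ := κ ^ (a - 1) / Complex.Gamma (a - c + 1) / (κ ^ (a - c) / Complex.Gamma a) with hq
  set Q : ℝ → ℂ := fun x => (x : ℂ) ^ (1 - c) * h x / f x - q with hQ
  have hQlim : Tendsto Q atTop (𝓝 0) := by
    have h1 := (lh.div lf hne).sub_const q
    rw [← hq, sub_self] at h1
    refine h1.congr' ?_
    filter_upwards [eventually_gt_atTop 0, hf0] with x hx hfx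
    have hx0 : (x : ℂ) ≠ 0 := by exact_mod_cast hx.ne'
    have hcp : (x : ℂ) ^ (c - a) ≠ 0 := by simp [Complex.cpow_eq_zero_iff, hx0]
    have he := Complex.exp_ne_zero (-κ * x)
    have : (x : ℂ) ^ (1 - a) = x ^ (1 - c) * x ^ (c - a) := by
      rw [← Complex.cpow_add _ _ hx0]; congr 1; ring
    simp only [hQ, Pi.div_apply, this]
    field_simp
  have hQd : ∀ᶠ x : ℝ in atTop, HasDerivAt Q ((x : ℂ) ^ (-c) * (D * Complex.exp (κ * x)) / f x ^ 2) x := by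
    filter_upwards [eventually_gt_atTop 0, hf0] with x hx hfx
    have hx0 : (x : ℂ) ≠ 0 := by exact_mod_cast hx.ne'
    have hp : HasDerivAt (fun x : ℝ => (x : ℂ) ^ (1 - c)) ((1 - c) * (x : ℂ) ^ (-c)) x := by
      have := ((hasDerivAt_id (x : ℂ)).cpow_const (c := 1 - c) (Or.inl (by simpa using hx))).comp_ofReal
      refine this.congr_deriv ?_
      rw [show 1 - c - 1 = -c by ring]; simp
    refine (((hp.mul (hasDerivAt_regF1_mul_ofReal (a - c + 1) (2 - c) κ x)).div
      (hasDerivAt_regF1_mul_ofReal a c κ x) hfx).sub_const q).congr_deriv ?_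
    have k1 := mul_deriv_regF1 a c (κ * x)
    have k3 := mul_deriv_regF1 (a - c + 1) (2 - c) (κ * x)
    have k5 := hD x hx
    have hxc : (x : ℂ) ^ (1 - c) = x ^ (-c) * x := by
      rw [show 1 - c = -c + 1 by ring, Complex.cpow_add _ _ hx0, Complex.cpow_one]
    simp only [Pi.mul_apply, hf] at hfx ⊢
    rw [hxc, ← k5]
    congr 1
    linear_combination (x : ℂ) ^ (-c) * regF1 a c (κ * x) * k3 -
      (x : ℂ) ^ (-c) * regF1 (a - c + 1) (2 - c) (κ * x) * k1
  have hfinv : (fun x => (f x)⁻¹) =O[atTop] fun x : ℝ => Real.exp (-κ.re * x) * x ^ (c - a).re := by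
    have h1 := (lf.inv₀ hne).isBigO_one ℝ
    have h2 := h1.mul (isBigO_refl (fun x : ℝ => Complex.exp (-κ * x) * (x : ℂ) ^ (c - a)) atTop).norm_right
    refine h2.congr' ?_ ?_
    · filter_upwards [eventually_gt_atTop 0] with x hx
      have hx0 : (x : ℂ) ≠ 0 := by exact_mod_cast hx.ne'
      have hcp : (x : ℂ) ^ (c - a) ≠ 0 := by simp [Complex.cpow_eq_zero_iff, hx0]
      have he := Complex.exp_ne_zero (-κ * x)
      field_simp
    · filter_upwards [eventually_gt_atTop 0] with x hx
      rw [one_mul, norm_exp_mul_cpow _ _ hx, Complex.neg_re]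
  have hfO : f =O[atTop] fun x : ℝ => Real.exp (κ.re * x) * x ^ (a - c).re := by
    have h1 := lf.isBigO_one ℝ
    have h2 := h1.mul (isBigO_refl (fun x : ℝ => Complex.exp (κ * x) * (x : ℂ) ^ (a - c)) atTop).norm_right
    refine h2.congr' ?_ ?_
    · filter_upwards [eventually_gt_atTop 0] with x hx
      have := exp_mul_cpow_mul_cancel κ (a - c) hx
      rw [neg_sub] at this
      linear_combination f x * this
    · filter_upwards [eventually_gt_atTop 0] with x hx
      rw [one_mul, norm_exp_mul_cpow _ _ hx]
  have hQ' : (fun x : ℝ => (x : ℂ) ^ (-c) * (D * Complex.exp (κ * x)) / f x ^ 2) =O[atTop]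
      fun x : ℝ => Real.exp (-κ.re * x) * x ^ (c - 2 * a).re := by
    have h1 := (((isBigO_refl (fun x : ℝ => Complex.exp (κ * x) * (x : ℂ) ^ (-c)) atTop).norm_right.mul
      hfinv).mul hfinv).const_mul_left D
    refine h1.congr' ?_ ?_
    · filter_upwards with x
      ring
    · filter_upwards [eventually_gt_atTop 0] with x hx
      rw [norm_exp_mul_cpow _ _ hx]
      have e1 : Real.exp (-κ.re * x) = Real.exp (κ.re * x) * Real.exp (-κ.re * x) * Real.exp (-κ.re * x) := by
        rw [← Real.exp_add, ← Real.exp_add]; congr 1; ring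
      have e2 : x ^ (c - 2 * a).re = x ^ (-c).re * x ^ (c - a).re * x ^ (c - a).re := by
        rw [← Real.rpow_add hx, ← Real.rpow_add hx]; congr 1; simp; ring
      conv_rhs => rw [e1, e2]
      ring
  have hQO := isBigO_of_deriv_isBigO_exp_neg hκ hQd hQlim hQ'
  have hfin := (hfO.mul hQO).const_mul_left (-(κ ^ (1 - c) / Complex.Gamma a))
  refine hfin.congr' ?_ ?_
  · filter_upwards [eventually_gt_atTop 0, hf0] with x hx hfx
    have e1 := mul_ofReal_cpow hκ0 hx (1 - c)
    have e2 : q = κ ^ (c - 1) * Complex.Gamma a / Complex.Gamma (a - c + 1) := by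
      have h3 : κ ^ (a - c) ≠ 0 := by simp [Complex.cpow_eq_zero_iff, hκ0]
      rw [hq, show a - 1 = (a - c) + (c - 1) by ring, Complex.cpow_add _ _ hκ0]
      field_simp
    have e3 : κ ^ (1 - c) * κ ^ (c - 1) = 1 := by
      rw [← Complex.cpow_add _ _ hκ0]; simp
    have e4 : f x * Q x = (x : ℂ) ^ (1 - c) * h x - q * f x := by
      simp only [hQ]; field_simp
    rw [e4, e2, e1]
    have e5 : κ ^ (1 - c) / Complex.Gamma a * (κ ^ (c - 1) * Complex.Gamma a / Complex.Gamma (a - c + 1)) =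
        1 / Complex.Gamma (a - c + 1) := by
      calc _ = κ ^ (1 - c) * κ ^ (c - 1) * (Complex.Gamma a / Complex.Gamma a) / Complex.Gamma (a - c + 1) := by ring
        _ = _ := by rw [e3, div_self hΓ, mul_one]
    linear_combination f x * e5
  · filter_upwards [eventually_gt_atTop 0] with x hx
    have e1 : Real.exp (κ.re * x) * Real.exp (-κ.re * x) = 1 := by
      rw [← Real.exp_add]; simp
    have e2 : x ^ (a - c).re * x ^ (c - 2 * a).re = x ^ (-a.re) := by
      rw [← Real.rpow_add hx]; congr 1; simp; ring
    rw [mul_mul_mul_comm, e1, e2, one_mul]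

lemma isBigO_regF1 {κ : ℂ} (hκ : 0 < κ.re) (a c : ℂ) :
    (fun x : ℝ => regF1 a c (κ * x)) =O[atTop]
      fun x : ℝ => Real.exp (κ.re * x) * x ^ (a - c).re := by
  have h1 := (tendsto_regF1 hκ a c).isBigO_one ℝ
  have h2 := h1.mul
    (isBigO_refl (fun x : ℝ => Complex.exp (κ * x) * (x : ℂ) ^ (a - c)) atTop).norm_right
  refine h2.congr' ?_ ?_
  · filter_upwards [eventually_gt_atTop 0] with x hx
    have := exp_mul_cpow_mul_cancel κ (a - c) hx
    rw [neg_sub] at this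
    linear_combination regF1 a c (κ * x) * this
  · filter_upwards [eventually_gt_atTop 0] with x hx
    rw [one_mul, norm_exp_mul_cpow _ _ hx]

lemma continuous_regF1 (a c : ℂ) : Continuous (regF1 a c) :=
  continuous_iff_continuousAt.2 fun z => (hasDerivAt_regF1 a c z).continuousAt

lemma WI_mul_ofReal {κ : ℂ} (hκ : κ ≠ 0) (β m : ℂ) {x : ℝ} (hx : 0 < x) :
    WI β m (κ * x) = κ ^ (1 / 2 + m) * (Complex.exp (-κ / 2 * x) * (x : ℂ) ^ (1 / 2 + m)) *
      regF1 (1 / 2 + m - β) (1 + 2 * m) (κ * x) := by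
  rw [WI, mul_ofReal_cpow hκ hx, show -(κ * x) / 2 = -κ / 2 * x by ring]
  ring

lemma isBigO_WI_zero {κ : ℂ} (hκ : κ ≠ 0) (β m : ℂ) :
    (fun x : ℝ => WI β m (κ * x)) =O[𝓝[>] 0] fun x : ℝ => x ^ (1 / 2 + m.re) := by
  have h1 : Continuous fun x : ℝ => κ ^ (1 / 2 + m) * Complex.exp (-κ / 2 * x) *
      regF1 (1 / 2 + m - β) (1 + 2 * m) (κ * x) := by
    have := continuous_regF1 (1 / 2 + m - β) (1 + 2 * m)
    fun_prop
  have h2 := ((h1.tendsto 0).mono_left nhdsWithin_le_nhds).isBigO_one ℝ (l := 𝓝[>] (0 : ℝ))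
  have h3 := h2.mul (isBigO_refl (fun x : ℝ => (x : ℂ) ^ (1 / 2 + m)) (𝓝[>] 0)).norm_right
  refine h3.congr' ?_ ?_
  · filter_upwards [self_mem_nhdsWithin] with x hx
    rw [WI_mul_ofReal hκ _ _ hx]
    ring
  · filter_upwards [self_mem_nhdsWithin] with x hx
    rw [one_mul, Complex.norm_cpow_eq_rpow_re_of_pos hx]
    simp

lemma isBigO_WI_atTop {κ : ℂ} (hκ : 0 < κ.re) (β m : ℂ) :
    (fun x : ℝ => WI β m (κ * x)) =O[atTop]
      fun x : ℝ => Real.exp (κ.re / 2 * x) * x ^ (-β.re) := by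
  have hκ0 : κ ≠ 0 := by rintro rfl; simp at hκ
  have h := (((isBigO_refl (fun x : ℝ => Complex.exp (-κ / 2 * x) * (x : ℂ) ^ (1 / 2 + m))
    atTop).norm_right.const_mul_left (κ ^ (1 / 2 + m)))).mul
    (isBigO_regF1 hκ (1 / 2 + m - β) (1 + 2 * m))
  refine h.congr' ?_ ?_
  · filter_upwards [eventually_gt_atTop 0] with x hx
    rw [WI_mul_ofReal hκ0 _ _ hx]
  · filter_upwards [eventually_gt_atTop 0] with x hx
    rw [norm_exp_mul_cpow _ _ hx, mul_mul_mul_comm, ← Real.exp_add, ← Real.rpow_add hx]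
    congr 2
    · simp; ring
    · simp; ring

lemma isBigO_WK_zero {κ : ℂ} (hκ : κ ≠ 0) (β m : ℂ) :
    (fun x : ℝ => WK β m (κ * x)) =O[𝓝[>] 0] fun x : ℝ => x ^ (1 / 2 - |m.re|) := by
  have key : ∀ m' : ℂ, -|m.re| ≤ m'.re →
      (fun x : ℝ => WI β m' (κ * x)) =O[𝓝[>] 0] fun x : ℝ => x ^ (1 / 2 - |m.re|) := by
    intro m' hm'
    refine (isBigO_WI_zero hκ β m').trans (IsBigO.of_bound 1 ?_)
    filter_upwards [Ioo_mem_nhdsGT (one_pos (α := ℝ))] with x hx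
    rw [one_mul, Real.norm_of_nonneg (Real.rpow_nonneg hx.1.le _),
      Real.norm_of_nonneg (Real.rpow_nonneg hx.1.le _)]
    exact Real.rpow_le_rpow_of_exponent_ge hx.1 hx.2.le (by linarith)
  have h1 := (key m (neg_abs_le _)).const_mul_left (Complex.Gamma (1 / 2 - m - β))⁻¹
  have h2 := (key (-m) (by simpa using le_abs_self m.re)).const_mul_left
    (Complex.Gamma (1 / 2 + m - β))⁻¹
  refine ((h1.sub h2).const_mul_left
    (-((Real.pi : ℂ) / Complex.sin (2 * (Real.pi : ℂ) * m)))).congr_left fun x => ?_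
  rw [WK]
  ring

lemma isBigO_WK_atTop {κ β m : ℂ} (hκ : 0 < κ.re) (h : ∀ n : ℕ, 1 / 2 + m - β ≠ -n) :
    (fun x : ℝ => WK β m (κ * x)) =O[atTop]
      fun x : ℝ => Real.exp (-(κ.re / 2) * x) * x ^ β.re := by
  have hκ0 : κ ≠ 0 := by rintro rfl; simp at hκ
  have h1 := ((isBigO_refl (fun x : ℝ => Complex.exp (-κ / 2 * x) * (x : ℂ) ^ (1 / 2 + m))
    atTop).norm_right.const_mul_left (-((Real.pi : ℂ) / Complex.sin (2 * (Real.pi : ℂ) * m)) *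
      κ ^ (1 / 2 + m))).mul (isBigO_regF1_recessive (c := 1 + 2 * m) hκ h)
  refine h1.congr' ?_ ?_
  · filter_upwards [eventually_gt_atTop 0] with x hx
    have hx0 : (x : ℂ) ≠ 0 := by exact_mod_cast hx.ne'
    have e (z : ℂ) (hz : z ≠ 0) : z ^ (1 / 2 + -m) = z ^ (1 / 2 + m) * z ^ (1 - (1 + 2 * m)) := by
      rw [← Complex.cpow_add _ _ hz]
      congr 1
      ring
    rw [WK, WI_mul_ofReal hκ0 _ _ hx, WI_mul_ofReal hκ0 _ _ hx, e κ hκ0, e x hx0,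
      show 1 / 2 + m - β - (1 + 2 * m) + 1 = 1 / 2 - m - β by ring,
      show 2 - (1 + 2 * m) = 1 - 2 * m by ring, mul_ofReal_cpow hκ0 hx,
      show 1 / 2 + -m - β = 1 / 2 - m - β by ring, show 1 + 2 * -m = 1 - 2 * m by ring]
    ring
  · filter_upwards [eventually_gt_atTop 0] with x hx
    rw [norm_exp_mul_cpow _ _ hx, mul_assoc, ← Real.rpow_add hx]
    congr 2
    · simp; ring
    · simp

lemma exists_norm_le_mul_of_isBigO {g : ℝ → ℂ} {w : ℝ → ℝ} (hg : ContinuousOn g (Set.Ioi 0))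
    (hw : ContinuousOn w (Set.Ioi 0)) (hpos : ∀ x, 0 < x → 0 < w x) (h0 : g =O[𝓝[>] 0] w)
    (h1 : g =O[atTop] w) : ∃ C, 0 < C ∧ ∀ x, 0 < x → ‖g x‖ ≤ C * w x := by
  obtain ⟨A, hA⟩ := h0.bound
  obtain ⟨ε, hε, hA⟩ := mem_nhdsGT_iff_exists_Ioo_subset.1 hA
  obtain ⟨B, hB⟩ := h1.bound
  obtain ⟨N, hN⟩ := eventually_atTop.1 hB
  have hsub : Set.Icc ε N ⊆ Set.Ioi 0 := fun x hx => lt_of_lt_of_le hε hx.1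
  obtain ⟨M, hM⟩ := isCompact_Icc.exists_bound_of_continuousOn (f := fun x => ‖g x‖ / w x)
    ((hg.mono hsub).norm.div (hw.mono hsub) fun x hx => (hpos x (hsub hx)).ne')
  refine ⟨max 1 (max A (max B M)), lt_of_lt_of_le one_pos (le_max_left _ _), fun x hx => ?_⟩
  have hwx := hpos x hx
  have key : ∀ K, K ≤ max 1 (max A (max B M)) → ‖g x‖ ≤ K * w x →
      ‖g x‖ ≤ max 1 (max A (max B M)) * w x :=
    fun K hK h => h.trans (mul_le_mul_of_nonneg_right hK hwx.le)
  rcases lt_or_ge x ε with h | h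
  · have := hA ⟨hx, h⟩
    rw [Set.mem_ofPred_eq, Real.norm_of_nonneg hwx.le] at this
    exact key A (by simp) this
  rcases le_or_gt N x with h' | h'
  · have := hN x h'
    rw [Real.norm_of_nonneg hwx.le] at this
    exact key B (by simp) this
  · have := (le_abs_self _).trans (hM x ⟨h, h'.le⟩)
    exact key M (by simp) ((div_le_iff₀ hwx).1 this)

lemma exists_norm_le_weight {g : ℝ → ℂ} {s b d : ℝ} (hg : ContinuousOn g (Set.Ioi 0))
    (h0 : g =O[𝓝[>] 0] fun x : ℝ => x ^ s)
    (h1 : g =O[atTop] fun x : ℝ => Real.exp (d * x) * x ^ b) :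
    ∃ C, 0 < C ∧ ∀ x, 0 < x →
      ‖g x‖ ≤ C * ((x / (1 + x)) ^ s * (1 + x) ^ b * Real.exp (d * x)) := by
  have hu : ∀ x : ℝ, 0 < x → 0 < x / (1 + x) := fun x hx => by positivity
  refine exists_norm_le_mul_of_isBigO hg ?_ (fun x hx => ?_) (h0.trans ?_) (h1.trans ?_)
  · refine fun x hx => ContinuousAt.continuousWithinAt ?_
    have hx : 0 < x := hx
    have : 1 + x ≠ 0 := by positivity
    have h2 := (hu x hx).ne'
    fun_prop (disch := first | assumption | exact Or.inl ‹_›)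
  · have := hu x hx
    positivity
  · have hc : ContinuousAt (fun x : ℝ => (1 + x) ^ (s - b) * Real.exp (-d * x)) 0 := by
      fun_prop (disch := norm_num)
    have h2 := (hc.tendsto.mono_left nhdsWithin_le_nhds).isBigO_one ℝ (l := 𝓝[>] (0 : ℝ))
    have h3 := h2.mul (isBigO_refl
      (fun x : ℝ => (x / (1 + x)) ^ s * (1 + x) ^ b * Real.exp (d * x)) (𝓝[>] 0))
    refine h3.congr' ?_ (Eventually.of_forall fun x => one_mul _)
    filter_upwards [self_mem_nhdsWithin] with x hx
    have hx : 0 < x := hx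
    have h4 : 0 < 1 + x := by positivity
    rw [Real.div_rpow hx.le h4.le, Real.rpow_sub h4, neg_mul, Real.exp_neg]
    field_simp
  · have hc : Tendsto (fun x : ℝ => x / (1 + x)) atTop (𝓝 1) := by
      have h5 := (tendsto_inv_atTop_zero.comp
        (tendsto_atTop_add_const_left atTop (1 : ℝ) tendsto_id)).const_sub 1
      rw [sub_zero] at h5
      refine h5.congr' ?_
      filter_upwards [eventually_gt_atTop 0] with x hx
      have h4 : 1 + x ≠ 0 := by positivity
      simp only [Function.comp, id]
      field_simp
      ring
    have h2 := (hc.rpow_const (p := b - s) (Or.inl one_ne_zero)).isBigO_one ℝ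
    have h3 := h2.mul (isBigO_refl
      (fun x : ℝ => (x / (1 + x)) ^ s * (1 + x) ^ b * Real.exp (d * x)) atTop)
    refine h3.congr' ?_ (Eventually.of_forall fun x => one_mul _)
    filter_upwards [eventually_gt_atTop 0] with x hx
    have h4 : 0 < 1 + x := by positivity
    rw [Real.rpow_sub (hu x hx), Real.div_rpow hx.le h4.le, Real.div_rpow hx.le h4.le]
    field_simp

lemma continuousOn_WI {κ : ℂ} (hκ : κ ≠ 0) (β m : ℂ) :
    ContinuousOn (fun x : ℝ => WI β m (κ * x)) (Set.Ioi 0) := by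
  refine ContinuousOn.congr (f := fun x : ℝ => κ ^ (1 / 2 + m) *
    (Complex.exp (-κ / 2 * x) * (x : ℂ) ^ (1 / 2 + m)) *
      regF1 (1 / 2 + m - β) (1 + 2 * m) (κ * x)) (fun x hx => ?_)
      fun x hx => WI_mul_ofReal hκ β m hx
  have h1 := continuous_regF1 (1 / 2 + m - β) (1 + 2 * m)
  have h2 : ContinuousAt (fun x : ℝ => (x : ℂ) ^ (1 / 2 + m)) x :=
    Complex.continuousAt_ofReal_cpow_const x _ (Or.inr (ne_of_gt hx))
  refine ContinuousAt.continuousWithinAt ?_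
  fun_prop

lemma continuousOn_WK {κ : ℂ} (hκ : κ ≠ 0) (β m : ℂ) :
    ContinuousOn (fun x : ℝ => WK β m (κ * x)) (Set.Ioi 0) :=
  continuousOn_const.mul (((continuousOn_WI hκ β m).div_const _).sub
    ((continuousOn_WI hκ β (-m)).div_const _))

lemma exists_norm_WI_le {κ : ℂ} (hκ : 0 < κ.re) (β m : ℂ) :
    ∃ C, 0 < C ∧ ∀ x : ℝ, 0 < x → ‖WI β m (κ * x)‖ ≤
      C * ((x / (1 + x)) ^ (1 / 2 + m.re) * (1 + x) ^ (-β.re) * Real.exp (κ.re / 2 * x)) := by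
  have hκ0 : κ ≠ 0 := by rintro rfl; simp at hκ
  exact exists_norm_le_weight (continuousOn_WI hκ0 β m) (isBigO_WI_zero hκ0 β m)
    (isBigO_WI_atTop hκ β m)

lemma exists_norm_WK_le {κ β m : ℂ} (hκ : 0 < κ.re) (h : ∀ n : ℕ, 1 / 2 + m - β ≠ -n) :
    ∃ C, 0 < C ∧ ∀ x : ℝ, 0 < x → ‖WK β m (κ * x)‖ ≤
      C * ((x / (1 + x)) ^ (1 / 2 - |m.re|) * (1 + x) ^ β.re * Real.exp (-(κ.re / 2) * x)) := by
  have hκ0 : κ ≠ 0 := by rintro rfl; simp at hκ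
  exact exists_norm_le_weight (continuousOn_WK hκ0 β m) (isBigO_WK_zero hκ0 β m)
    (isBigO_WK_atTop hκ h)

/-- A weighted Schur test: a kernel `A x * A y * H x y ^ 2` with `H` symmetric and
`∫⁻ y, A y ^ 2 * H x y ^ 2 ≤ S` acts on `L²` with norm at most `S`. -/
lemma lintegral_sq_lintegral_mul_le {α : Type*} [MeasurableSpace α] {μ : Measure α} [SFinite μ]
    {A : α → ENNReal} {H : α → α → ENNReal} (hA : Measurable A)
    (hH : Measurable (Function.uncurry H)) (hsymm : ∀ x y, H x y = H y x) {S : ENNReal}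
    (hS : ∀ x, ∫⁻ y, A y ^ 2 * H x y ^ 2 ∂μ ≤ S) {g : α → ENNReal} (hg : Measurable g) :
    ∫⁻ x, (∫⁻ y, A x * A y * H x y ^ 2 * g y ∂μ) ^ 2 ∂μ ≤ S ^ 2 * ∫⁻ y, g y ^ 2 ∂μ := by
  have hHx : ∀ x, Measurable (H x) := fun x => hH.comp measurable_prodMk_left
  have hcs : ∀ x, (∫⁻ y, A x * A y * H x y ^ 2 * g y ∂μ) ^ 2 ≤
      ∫⁻ y, S * (A x ^ 2 * H x y ^ 2 * g y ^ 2) ∂μ := by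
    intro x
    have hsq : ∀ t : ENNReal, (t ^ (1 / 2 : ℝ)) ^ 2 = t := fun t => by
      rw [← ENNReal.rpow_natCast, ← ENNReal.rpow_mul]; norm_num
    have h1 := ENNReal.lintegral_mul_le_Lp_mul_Lq μ Real.HolderConjugate.two_two
      (f := fun y => A y * H x y) (g := fun y => H x y * g y)
      (hA.mul (hHx x)).aemeasurable ((hHx x).mul hg).aemeasurable
    calc (∫⁻ y, A x * A y * H x y ^ 2 * g y ∂μ) ^ 2
        = (A x * ∫⁻ y, ((fun y => A y * H x y) * fun y => H x y * g y) y ∂μ) ^ 2 := by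
          rw [← lintegral_const_mul]
          · congr 1
            refine lintegral_congr fun y => ?_
            simp only [Pi.mul_apply]
            ring
          · exact (hA.mul (hHx x)).mul ((hHx x).mul hg)
      _ ≤ (A x * ((∫⁻ y, (A y * H x y) ^ (2 : ℝ) ∂μ) ^ (1 / 2 : ℝ) *
            (∫⁻ y, (H x y * g y) ^ (2 : ℝ) ∂μ) ^ (1 / 2 : ℝ))) ^ 2 := by gcongr
      _ = A x ^ 2 * ((∫⁻ y, A y ^ 2 * H x y ^ 2 ∂μ) * ∫⁻ y, H x y ^ 2 * g y ^ 2 ∂μ) := by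
          rw [mul_pow, mul_pow, hsq, hsq]
          simp only [ENNReal.rpow_two, mul_pow]
      _ ≤ A x ^ 2 * (S * ∫⁻ y, H x y ^ 2 * g y ^ 2 ∂μ) := by gcongr; exact hS x
      _ = ∫⁻ y, S * (A x ^ 2 * H x y ^ 2 * g y ^ 2) ∂μ := by
          have hm : Measurable fun y => H x y ^ 2 * g y ^ 2 := ((hHx x).pow_const 2).mul (hg.pow_const 2)
          simp only [mul_assoc]
          rw [lintegral_const_mul _ (hm.const_mul _), lintegral_const_mul _ hm]
          ring
  have hm2 : Measurable (Function.uncurry fun x y => S * (A x ^ 2 * H x y ^ 2 * g y ^ 2)) :=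
    ((((hA.comp measurable_fst).pow_const 2).mul (hH.pow_const 2)).mul
      ((hg.comp measurable_snd).pow_const 2)).const_mul S
  calc ∫⁻ x, (∫⁻ y, A x * A y * H x y ^ 2 * g y ∂μ) ^ 2 ∂μ
      ≤ ∫⁻ x, ∫⁻ y, S * (A x ^ 2 * H x y ^ 2 * g y ^ 2) ∂μ ∂μ := lintegral_mono hcs
    _ = ∫⁻ y, ∫⁻ x, S * (A x ^ 2 * H x y ^ 2 * g y ^ 2) ∂μ ∂μ :=
        lintegral_lintegral_swap hm2.aemeasurable
    _ ≤ ∫⁻ y, S ^ 2 * g y ^ 2 ∂μ := by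
        refine lintegral_mono fun y => ?_
        have hm : Measurable fun x => A x ^ 2 * H y x ^ 2 := (hA.pow_const 2).mul ((hHx y).pow_const 2)
        calc ∫⁻ x, S * (A x ^ 2 * H x y ^ 2 * g y ^ 2) ∂μ
            = S * ((∫⁻ x, A x ^ 2 * H y x ^ 2 ∂μ) * g y ^ 2) := by
              simp only [hsymm _ y]
              rw [lintegral_const_mul _ (hm.mul_const _), lintegral_mul_const _ hm]
          _ ≤ S * (S * g y ^ 2) := by gcongr; exact hS y
          _ = S ^ 2 * g y ^ 2 := by ring
    _ = S ^ 2 * ∫⁻ y, g y ^ 2 ∂μ := lintegral_const_mul _ (hg.pow_const 2)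

/-- The weighted Schur test for Bochner integrals. -/
lemma integrable_and_sqrt_integral_le {α : Type*} [MeasurableSpace α] {μ : Measure α} [SFinite μ]
    {K : α → α → ℂ} (hK : Measurable (Function.uncurry K))
    {A : α → ENNReal} {H : α → α → ENNReal} (hA : Measurable A)
    (hH : Measurable (Function.uncurry H)) (hsymm : ∀ x y, H x y = H y x) {C S : ENNReal}
    (hC : C ≠ ⊤) (hS' : S ≠ ⊤) (hS : ∀ x, ∫⁻ y, A y ^ 2 * H x y ^ 2 ∂μ ≤ S)
    (hKA : ∀ᵐ x ∂μ, ∀ᵐ y ∂μ, ‖K x y‖ₑ ≤ C * (A x * A y * H x y ^ 2))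
    {f : α → ℂ} (hf : Measurable f) (hf2 : Integrable (fun y => ‖f y‖ ^ 2) μ) :
    Integrable (fun x => ‖∫ y, K x y * f y ∂μ‖ ^ 2) μ ∧
      Real.sqrt (∫ x, ‖∫ y, K x y * f y ∂μ‖ ^ 2 ∂μ) ≤
        (C * S).toReal * Real.sqrt (∫ y, ‖f y‖ ^ 2 ∂μ) := by
  have hTm : StronglyMeasurable fun x => ∫ y, K x y * f y ∂μ :=
    StronglyMeasurable.integral_prod_right
      (hK.mul (hf.comp measurable_snd)).stronglyMeasurable
  have hofReal : ∀ z : ℂ, ENNReal.ofReal (‖z‖ ^ 2) = ‖z‖ₑ ^ 2 := fun z => by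
    rw [ENNReal.ofReal_pow (norm_nonneg _), ofReal_norm]
  have hHx : ∀ x, Measurable (H x) := fun x => hH.comp measurable_prodMk_left
  have hle : ∫⁻ x, ‖∫ y, K x y * f y ∂μ‖ₑ ^ 2 ∂μ ≤ (C * S) ^ 2 * ∫⁻ y, ‖f y‖ₑ ^ 2 ∂μ := by
    calc ∫⁻ x, ‖∫ y, K x y * f y ∂μ‖ₑ ^ 2 ∂μ
        ≤ ∫⁻ x, C ^ 2 * (∫⁻ y, A x * A y * H x y ^ 2 * ‖f y‖ₑ ∂μ) ^ 2 ∂μ := by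
          refine lintegral_mono_ae ?_
          filter_upwards [hKA] with x hx
          rw [← mul_pow]
          gcongr
          refine (enorm_integral_le_lintegral_enorm _).trans ?_
          rw [← lintegral_const_mul' _ _ hC]
          refine lintegral_mono_ae ?_
          filter_upwards [hx] with y hy
          rw [enorm_mul, ← mul_assoc]
          gcongr
      _ = C ^ 2 * ∫⁻ x, (∫⁻ y, A x * A y * H x y ^ 2 * ‖f y‖ₑ ∂μ) ^ 2 ∂μ :=
          lintegral_const_mul' _ _ (ENNReal.pow_ne_top hC)
      _ ≤ C ^ 2 * (S ^ 2 * ∫⁻ y, ‖f y‖ₑ ^ 2 ∂μ) := by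
          gcongr
          exact lintegral_sq_lintegral_mul_le hA hH hsymm hS hf.enorm
      _ = (C * S) ^ 2 * ∫⁻ y, ‖f y‖ₑ ^ 2 ∂μ := by ring
  have hffin : ∫⁻ y, ‖f y‖ₑ ^ 2 ∂μ ≠ ⊤ := by
    have := hf2.lintegral_lt_top
    simp only [hofReal] at this
    exact this.ne
  have hrhs : (C * S) ^ 2 * ∫⁻ y, ‖f y‖ₑ ^ 2 ∂μ ≠ ⊤ :=
    ENNReal.mul_ne_top (ENNReal.pow_ne_top (ENNReal.mul_ne_top hC hS')) hffin
  have hsm : AEStronglyMeasurable (fun x => ‖∫ y, K x y * f y ∂μ‖ ^ 2) μ :=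
    (hTm.norm.pow 2).aestronglyMeasurable
  refine ⟨⟨hsm, ?_⟩, ?_⟩
  · rw [hasFiniteIntegral_iff_ofReal (ae_of_all _ fun x => by positivity)]
    simp only [hofReal]
    exact lt_of_le_of_lt hle hrhs.lt_top
  · rw [integral_eq_lintegral_of_nonneg_ae (ae_of_all _ fun x => by positivity) hsm,
      integral_eq_lintegral_of_nonneg_ae (ae_of_all _ fun x => by positivity) hf2.1]
    simp only [hofReal]
    refine Real.sqrt_le_iff.2 ⟨by positivity, ?_⟩
    rw [mul_pow, Real.sq_sqrt ENNReal.toReal_nonneg, ← ENNReal.toReal_pow, ← ENNReal.toReal_mul]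
    exact ENNReal.toReal_mono hrhs hle

lemma lintegral_exp_neg_mul_abs_lt_top {ε : ℝ} (hε : 0 < ε) :
    ∫⁻ t : ℝ, ENNReal.ofReal (Real.exp (-ε * |t|)) < ⊤ := by
  refine Integrable.lintegral_lt_top ?_
  rw [← integrableOn_univ, ← Set.Iic_union_Ioi (a := (0 : ℝ))]
  refine IntegrableOn.union ?_ ?_
  · refine (integrableOn_exp_mul_Iic hε 0).congr_fun (fun t ht => ?_) measurableSet_Iic
    simp only
    rw [abs_of_nonpos ht]
    ring_nf
  · refine (integrableOn_exp_mul_Ioi (neg_lt_zero.2 hε) 0).congr_fun (fun t ht => ?_)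
      measurableSet_Ioi
    simp only
    rw [abs_of_pos ht]

lemma exists_lintegral_weight_le {σ ε : ℝ} (hσ0 : 0 ≤ σ) (hσ : σ < 1 / 2) (hε : 0 < ε) :
    ∃ S : ENNReal, S ≠ ⊤ ∧ ∀ x : ℝ, ∫⁻ y in Set.Ioi (0 : ℝ),
      ENNReal.ofReal ((y / (1 + y)) ^ (-σ)) ^ 2 *
        ENNReal.ofReal (Real.exp (-(ε / 2) * |x - y|)) ^ 2 ≤ S := by
  have hfin : ∫⁻ y in Set.Ioo (0 : ℝ) 1, ENNReal.ofReal (y ^ (-(2 * σ))) < ⊤ :=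
    Integrable.lintegral_lt_top
      ((intervalIntegral.integrableOn_Ioo_rpow_iff one_pos).2 (by linarith))
  refine ⟨(∫⁻ y in Set.Ioo (0 : ℝ) 1, ENNReal.ofReal (y ^ (-(2 * σ)))) +
    2 * ∫⁻ t : ℝ, ENNReal.ofReal (Real.exp (-ε * |t|)),
    ENNReal.add_ne_top.2 ⟨hfin.ne, ENNReal.mul_ne_top (by simp)
      (lintegral_exp_neg_mul_abs_lt_top hε).ne⟩, fun x => ?_⟩
  have hpt : ∀ y ∈ Set.Ioi (0 : ℝ), ENNReal.ofReal ((y / (1 + y)) ^ (-σ)) ^ 2 *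
      ENNReal.ofReal (Real.exp (-(ε / 2) * |x - y|)) ^ 2 ≤
      (Set.Ioo (0 : ℝ) 1).indicator (fun y => ENNReal.ofReal (y ^ (-(2 * σ)))) y +
        2 * ENNReal.ofReal (Real.exp (-ε * |x - y|)) := by
    intro y hy
    have hy : 0 < y := hy
    have h1y : 0 < 1 + y := by positivity
    have hexp : Real.exp (-(ε / 2) * |x - y|) ^ 2 = Real.exp (-ε * |x - y|) := by
      rw [← Real.exp_nat_mul]; congr 1; push_cast; ring
    have hw : ((y / (1 + y)) ^ (-σ)) ^ 2 ≤ 1 + y ^ (-(2 * σ)) := by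
      calc ((y / (1 + y)) ^ (-σ)) ^ 2 = (1 + y⁻¹) ^ (2 * σ) := by
            rw [← Real.rpow_natCast, ← Real.rpow_mul (by positivity),
              show -σ * (2 : ℕ) = -(2 * σ) by push_cast; ring, Real.rpow_neg (by positivity),
              ← Real.inv_rpow (by positivity)]
            congr 1
            field_simp
            ring
        _ ≤ 1 ^ (2 * σ) + y⁻¹ ^ (2 * σ) :=
            Real.rpow_add_le_add_rpow zero_le_one (by positivity) (by linarith) (by linarith)
        _ = 1 + y ^ (-(2 * σ)) := by
            rw [Real.one_rpow, Real.inv_rpow hy.le, Real.rpow_neg hy.le]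
    have hexp1 : Real.exp (-ε * |x - y|) ≤ 1 :=
      Real.exp_le_one_iff.2 (by have := abs_nonneg (x - y); nlinarith)
    have hexp0 := Real.exp_pos (-ε * |x - y|)
    have hp := Real.rpow_nonneg hy.le (-(2 * σ))
    rw [← ENNReal.ofReal_pow (by positivity), ← ENNReal.ofReal_pow (by positivity), hexp,
      ← ENNReal.ofReal_mul (by positivity), ← ENNReal.ofReal_ofNat 2,
      ← ENNReal.ofReal_mul (by positivity)]
    by_cases hy1 : y < 1
    · rw [Set.indicator_of_mem (Set.mem_Ioo.2 ⟨hy, hy1⟩), ← ENNReal.ofReal_add hp (by positivity)]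
      refine ENNReal.ofReal_le_ofReal ?_
      nlinarith [mul_le_mul_of_nonneg_right hw hexp0.le]
    · rw [Set.indicator_of_notMem fun h => hy1 h.2, zero_add]
      refine ENNReal.ofReal_le_ofReal (mul_le_mul_of_nonneg_right (hw.trans ?_) hexp0.le)
      have := Real.rpow_le_one_of_one_le_of_nonpos (not_lt.1 hy1) (show -(2 * σ) ≤ 0 by linarith)
      linarith
  calc _ ≤ ∫⁻ y in Set.Ioi (0 : ℝ),
        ((Set.Ioo (0 : ℝ) 1).indicator (fun y => ENNReal.ofReal (y ^ (-(2 * σ)))) y +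
          2 * ENNReal.ofReal (Real.exp (-ε * |x - y|))) :=
        setLIntegral_mono' measurableSet_Ioi hpt
    _ ≤ ∫⁻ y, ((Set.Ioo (0 : ℝ) 1).indicator (fun y => ENNReal.ofReal (y ^ (-(2 * σ)))) y +
          2 * ENNReal.ofReal (Real.exp (-ε * |x - y|))) := setLIntegral_le_lintegral _ _
    _ = _ := by
        rw [lintegral_add_right _ (by fun_prop), lintegral_indicator measurableSet_Ioo,
          lintegral_const_mul _ (by fun_prop),
          lintegral_sub_left_eq_self (fun t => ENNReal.ofReal (Real.exp (-ε * |t|))) x]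

lemma exists_one_add_rpow_le_exp (p : ℝ) {ε : ℝ} (hp : 0 ≤ p) (hε : 0 < ε) :
    ∃ C, 0 < C ∧ ∀ t : ℝ, 0 ≤ t → (1 + t) ^ p ≤ C * Real.exp (ε * t) := by
  set η := ε / (p + 1) with hη
  have hη0 : 0 < η := by positivity
  refine ⟨(1 + η⁻¹) ^ p, by positivity, fun t ht => ?_⟩
  have h1 : 1 + t ≤ (1 + η⁻¹) * Real.exp (η * t) := by
    have h2 := Real.add_one_le_exp (η * t)
    have h3 : (1 + η⁻¹) * (η * t + 1) = 1 + t + (η * t + η⁻¹) := by field_simp; ring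
    have h4 : 0 ≤ η * t + η⁻¹ := by positivity
    nlinarith [mul_le_mul_of_nonneg_left h2 (show 0 ≤ 1 + η⁻¹ by positivity)]
  calc (1 + t) ^ p ≤ ((1 + η⁻¹) * Real.exp (η * t)) ^ p :=
        Real.rpow_le_rpow (by positivity) h1 hp
    _ = (1 + η⁻¹) ^ p * Real.exp (η * t * p) := by
        rw [Real.mul_rpow (by positivity) (by positivity), ← Real.exp_mul]
    _ ≤ (1 + η⁻¹) ^ p * Real.exp (ε * t) := by
        have h5 : η * p ≤ ε := by
          rw [hη, div_mul_eq_mul_div, div_le_iff₀ (by positivity)]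
          nlinarith
        have h6 : η * t * p ≤ ε * t := by nlinarith [mul_le_mul_of_nonneg_right h5 ht]
        gcongr

lemma rpow_mul_rpow_le {u v μ σ : ℝ} (hu : 0 < u) (huv : u ≤ v) (hv : v ≤ 1) (hσ0 : 0 ≤ σ)
    (hσ : -(1 / 2) - μ ≤ σ) :
    u ^ (1 / 2 + μ) * v ^ (1 / 2 - |μ|) ≤ u ^ (-σ) * v ^ (-σ) := by
  have hv0 : 0 < v := hu.trans_le huv
  rcases le_or_gt 0 μ with h | h
  · rw [abs_of_nonneg h]
    have h1 : u ^ (1 / 2 + μ) * v ^ (1 / 2 - μ) ≤ 1 := by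
      calc u ^ (1 / 2 + μ) * v ^ (1 / 2 - μ) ≤ v ^ (1 / 2 + μ) * v ^ (1 / 2 - μ) := by gcongr
        _ = v := by rw [← Real.rpow_add hv0]; ring_nf; exact Real.rpow_one v
        _ ≤ 1 := hv
    refine h1.trans (one_le_mul_of_one_le_of_one_le ?_ ?_)
    · exact Real.one_le_rpow_of_pos_of_le_one_of_nonpos hu (huv.trans hv) (by linarith)
    · exact Real.one_le_rpow_of_pos_of_le_one_of_nonpos hv0 hv (by linarith)
  · rw [abs_of_neg h]
    exact mul_le_mul (Real.rpow_le_rpow_of_exponent_ge hu (huv.trans hv) (by linarith))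
      (Real.rpow_le_rpow_of_exponent_ge hv0 hv (by linarith)) (by positivity) (by positivity)

lemma div_rpow_le_one_add_sub_rpow {x y : ℝ} (b : ℝ) (hx : 0 < x) (hxy : x ≤ y) :
    (1 + x) ^ (-b) * (1 + y) ^ b ≤ (1 + (y - x)) ^ |b| := by
  have h1x : 0 < 1 + x := by positivity
  have h1y : 0 < 1 + y := by linarith
  have h1 : 1 ≤ (1 + y) / (1 + x) := (one_le_div h1x).2 (by linarith)
  calc (1 + x) ^ (-b) * (1 + y) ^ b = ((1 + y) / (1 + x)) ^ b := by
        rw [Real.div_rpow h1y.le h1x.le, Real.rpow_neg h1x.le]; field_simp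
    _ ≤ ((1 + y) / (1 + x)) ^ |b| := Real.rpow_le_rpow_of_exponent_le h1 (le_abs_self b)
    _ ≤ (1 + (y - x)) ^ |b| := by
        refine Real.rpow_le_rpow (by positivity) ?_ (abs_nonneg b)
        rw [div_le_iff₀ h1x]
        nlinarith

lemma exists_weight_mul_weight_le {δ μ σ : ℝ} (b : ℝ) (hδ : 0 < δ) (hσ0 : 0 ≤ σ)
    (hσ : -(1 / 2) - μ ≤ σ) : ∃ C, 0 < C ∧ ∀ x y : ℝ, 0 < x → x ≤ y →
      ((x / (1 + x)) ^ (1 / 2 + μ) * (1 + x) ^ (-b) * Real.exp (δ * x)) *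
        ((y / (1 + y)) ^ (1 / 2 - |μ|) * (1 + y) ^ b * Real.exp (-δ * y)) ≤
      C * ((x / (1 + x)) ^ (-σ) * (y / (1 + y)) ^ (-σ) * Real.exp (-(δ / 2) * (y - x))) := by
  obtain ⟨C, hC, h⟩ := exists_one_add_rpow_le_exp |b| (abs_nonneg b) (half_pos hδ)
  refine ⟨C, hC, fun x y hx hxy => ?_⟩
  have hy : 0 < y := hx.trans_le hxy
  have h1 := rpow_mul_rpow_le (u := x / (1 + x)) (v := y / (1 + y)) (by positivity)
    (by rw [div_le_div_iff₀ (by positivity) (by positivity)]; nlinarith)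
    ((div_le_one (by positivity)).2 (by linarith)) hσ0 hσ
  have h2 := (div_rpow_le_one_add_sub_rpow b hx hxy).trans (h (y - x) (by linarith))
  have e : Real.exp (δ / 2 * (y - x)) * (Real.exp (δ * x) * Real.exp (-δ * y)) =
      Real.exp (-(δ / 2) * (y - x)) := by
    rw [← Real.exp_add, ← Real.exp_add]; congr 1; ring
  calc _ = ((x / (1 + x)) ^ (1 / 2 + μ) * (y / (1 + y)) ^ (1 / 2 - |μ|)) *
        (((1 + x) ^ (-b) * (1 + y) ^ b) * (Real.exp (δ * x) * Real.exp (-δ * y))) := by ring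
    _ ≤ ((x / (1 + x)) ^ (-σ) * (y / (1 + y)) ^ (-σ)) *
        ((C * Real.exp (δ / 2 * (y - x))) * (Real.exp (δ * x) * Real.exp (-δ * y))) := by gcongr
    _ = _ := by rw [mul_assoc C, e]; ring

lemma exists_norm_resKer_le {m β k : ℂ} (hk : 0 < k.re)
    (hNk : ∀ n : ℕ, β / (2 * k) - m - 1 / 2 ≠ (n : ℂ)) {σ : ℝ} (hσ0 : 0 ≤ σ)
    (hσ : -(1 / 2) - m.re ≤ σ) : ∃ C, 0 < C ∧ ∀ x y : ℝ, 0 < x → 0 < y →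
      ‖resKer m β k x y‖ ≤ C * ((x / (1 + x)) ^ (-σ) * (y / (1 + y)) ^ (-σ) *
        Real.exp (-(k.re / 2) * |x - y|)) := by
  have hκre : (2 * k).re = 2 * k.re := by simp
  have hκ : 0 < (2 * k).re := by rw [hκre]; positivity
  obtain ⟨C₁, hC₁, h₁⟩ := exists_norm_WI_le hκ (β / (2 * k)) m
  obtain ⟨C₂, hC₂, h₂⟩ := exists_norm_WK_le (β := β / (2 * k)) (m := m) hκ
    fun n h => hNk n (by linear_combination -h)
  obtain ⟨C₃, hC₃, h₃⟩ := exists_weight_mul_weight_le (β / (2 * k)).re hk hσ0 hσ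
  rw [hκre, mul_div_cancel_left₀ _ two_ne_zero] at h₁ h₂
  set M := ‖1 / (2 * k) * Complex.Gamma (1 / 2 + m - β / (2 * k))‖ with hM
  refine ⟨(M + 1) * (C₁ * C₂ * C₃), by positivity, fun x y hx hy => ?_⟩
  have key : ∀ s t : ℝ, 0 < s → s ≤ t →
      ‖WI (β / (2 * k)) m (2 * k * s)‖ * ‖WK (β / (2 * k)) m (2 * k * t)‖ ≤
      C₁ * C₂ * C₃ * ((s / (1 + s)) ^ (-σ) * (t / (1 + t)) ^ (-σ) *
        Real.exp (-(k.re / 2) * (t - s))) := by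
    intro s t hs hst
    calc _ ≤ _ := mul_le_mul (h₁ s hs) (h₂ t (hs.trans_le hst)) (norm_nonneg _)
          ((norm_nonneg _).trans (h₁ s hs))
      _ = C₁ * C₂ * _ := mul_mul_mul_comm _ _ _ _
      _ ≤ C₁ * C₂ * _ := mul_le_mul_of_nonneg_left (h₃ s t hs hst) (by positivity)
      _ = _ := by ring
  have key2 : ‖WI (β / (2 * k)) m (2 * k * (min x y : ℝ))‖ *
      ‖WK (β / (2 * k)) m (2 * k * (max x y : ℝ))‖ ≤
      C₁ * C₂ * C₃ * ((x / (1 + x)) ^ (-σ) * (y / (1 + y)) ^ (-σ) *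
        Real.exp (-(k.re / 2) * |x - y|)) := by
    rcases le_total x y with h | h
    · rw [min_eq_left h, max_eq_right h, abs_of_nonpos (by linarith), neg_sub]
      exact key x y hx h
    · rw [min_eq_right h, max_eq_left h, abs_of_nonneg (by linarith),
        mul_comm ((x / (1 + x)) ^ (-σ))]
      exact key y x hy h
  rw [resKer, norm_mul, norm_mul, ← hM, mul_assoc, mul_assoc (M + 1)]
  exact mul_le_mul (by linarith) key2 (by positivity) (by positivity)

lemma measurable_WI (β m : ℂ) : Measurable (WI β m) := by
  have h := (continuous_regF1 (1 / 2 + m - β) (1 + 2 * m)).measurable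
  unfold WI
  fun_prop

lemma measurable_WK (β m : ℂ) : Measurable (WK β m) := by
  have h1 := measurable_WI β m
  have h2 := measurable_WI β (-m)
  unfold WK
  fun_prop

lemma measurable_resKer (m β k : ℂ) : Measurable (Function.uncurry (resKer m β k)) := by
  have h1 := measurable_WI (β / (2 * k)) m
  have h2 := measurable_WK (β / (2 * k)) m
  unfold resKer Function.uncurry
  fun_prop

/-- For `Re m > −1`, `2m ∉ ℤ`, `Re k > 0` and `β/(2k) − m − 1/2 ∉ ℕ`, the integral
operator with kernel `R` is bounded on `L²((0,∞))`. -/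
theorem resolvent_kernel_bounded (m β : ℂ) (hm : -1 < m.re)
    (hm2 : ∀ n : ℤ, 2 * m ≠ (n : ℂ)) (k : ℂ) (hk : 0 < k.re)
    (hNk : ∀ n : ℕ, β / (2 * k) - m - 1 / 2 ≠ (n : ℂ)) :
    ∃ C : ℝ, 0 ≤ C ∧
      ∀ f : ℝ → ℂ, Continuous f → HasCompactSupport f → tsupport f ⊆ Set.Ioi 0 →
        MeasureTheory.IntegrableOn
          (fun x : ℝ => ‖∫ y in Set.Ioi (0 : ℝ), resKer m β k x y * f y‖ ^ 2)
          (Set.Ioi 0) ∧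
        Real.sqrt (∫ x in Set.Ioi (0 : ℝ), ‖∫ y in Set.Ioi (0 : ℝ), resKer m β k x y * f y‖ ^ 2)
          ≤ C * Real.sqrt (∫ y in Set.Ioi (0 : ℝ), ‖f y‖ ^ 2) := by
  set σ : ℝ := max 0 (-(1 / 2) - m.re) with hσ
  have hσ0 : 0 ≤ σ := le_max_left _ _
  have hσ1 : σ < 1 / 2 := max_lt (by norm_num) (by linarith)
  obtain ⟨C, hC, hCK⟩ := exists_norm_resKer_le hk hNk hσ0 (le_max_right _ _)
  obtain ⟨S, hS', hS⟩ := exists_lintegral_weight_le hσ0 hσ1 (half_pos hk)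
  refine ⟨(ENNReal.ofReal C * S).toReal, ENNReal.toReal_nonneg, fun f hf hfc _ => ?_⟩
  refine integrable_and_sqrt_integral_le (measurable_resKer m β k)
    (A := fun y => ENNReal.ofReal ((y / (1 + y)) ^ (-σ)))
    (H := fun x y => ENNReal.ofReal (Real.exp (-(k.re / 2 / 2) * |x - y|)))
    (by fun_prop) (by unfold Function.uncurry; fun_prop)
    (fun x y => by rw [abs_sub_comm]) ENNReal.ofReal_ne_top hS' hS ?_ hf.measurable ?_
  · filter_upwards [ae_restrict_mem measurableSet_Ioi] with x hx
    filter_upwards [ae_restrict_mem measurableSet_Ioi] with y hy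
    have hx : 0 < x := hx
    have hy : 0 < y := hy
    have hexp : Real.exp (-(k.re / 2 / 2) * |x - y|) ^ 2 = Real.exp (-(k.re / 2) * |x - y|) := by
      rw [← Real.exp_nat_mul]; congr 1; push_cast; ring
    rw [← ENNReal.ofReal_pow (by positivity), hexp, ← ENNReal.ofReal_mul (by positivity),
      ← ENNReal.ofReal_mul (by positivity), ← ENNReal.ofReal_mul hC.le, ← ofReal_norm]
    exact ENNReal.ofReal_le_ofReal (hCK x y hx hy)
  · have h1 : Continuous fun y => ‖f y‖ ^ 2 := hf.norm.pow 2
    have h2 : HasCompactSupport fun y => ‖f y‖ ^ 2 :=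
      hfc.mono' (Function.support_subset_iff'.2 (fun y hy => by
        simp [image_eq_zero_of_notMem_tsupport hy]))
    exact (h1.integrable_of_hasCompactSupport h2).restrict
end

section
/- Let p ∈ ℕ, let β ∈ ℂ be such that (1+p)/2 − β is not a nonpositive integer, and let x > 0. Then the limit of 𝒦_{β,μ}(x) as μ → p/2 through complex μ with 2μ ∉ ℤ exists and equals (−1)^{p+1}·ln(x)·ℐ_{β,p/2}(x)/Γ((1−p)/2 − β) + (−1)^{p+1}·(e^{−x/2}/Γ((1−p)/2 − β))·Σ_{k=0}^∞ ((1+p)/2−β)_k·x^{(1+p)/2+k}/((p+k)!·k!)·( ψ((1+p)/2−β+k) − ψ(p+1+k) − ψ(1+k) ) + e^{−x/2}·Σ_{j=0}^{p−1} ((1−p)/2−β)_j·(−1)^j·(p−j−1)!·x^{(1−p)/2+j}/( j!·Γ((1+p)/2−β) ). -/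
/-- The digamma function `ψ(z) = Γ'(z)/Γ(z)`. -/
noncomputable def digammaC (z : ℂ) : ℂ := deriv Complex.Gamma z / Complex.Gamma z

section Whittaker

open Complex Filter Topology

lemma poch_succ (a : ℂ) (k : ℕ) : poch a (k + 1) = poch a k * (a + k) :=
  Finset.prod_range_succ _ _

lemma differentiable_poch (k : ℕ) : Differentiable ℂ fun a => poch a k := by
  unfold poch
  fun_prop

lemma poch_neg_nat_self (n : ℕ) : poch (-(n : ℂ)) n = (-1) ^ n * (n.factorial : ℂ) := by
  rw [poch, ← Finset.prod_range_reflect, ← Finset.prod_range_add_one_eq_factorial]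
  push_cast
  rw [← Finset.card_range n, ← Finset.prod_const, Finset.card_range, ← Finset.prod_mul_distrib]
  refine Finset.prod_congr rfl fun i hi => ?_
  have hi : i < n := Finset.mem_range.mp hi
  rw [Nat.sub_sub, Nat.cast_sub (by lia)]
  push_cast
  ring

lemma inv_Gamma_eq_poch_mul (z : ℂ) (n : ℕ) :
    (Gamma z)⁻¹ = poch z n * (Gamma (z + n))⁻¹ := by
  induction n with
  | zero => simp [poch]
  | succ n ih =>
    rw [ih, one_div_Gamma_eq_self_mul_one_div_Gamma_add_one (z + n), poch_succ]
    push_cast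
    rw [add_assoc z, mul_assoc]

lemma poch_eq_Gamma_mul_inv_Gamma {z : ℂ} {n : ℕ} (h : Gamma (z + n) ≠ 0) :
    poch z n = Gamma (z + n) * (Gamma z)⁻¹ := by
  rw [inv_Gamma_eq_poch_mul z n]
  field_simp

lemma hasDerivAt_inv_Gamma {z : ℂ} (hz : ∀ m : ℕ, z ≠ -m) :
    HasDerivAt (fun s => (Gamma s)⁻¹) (-digammaC z * (Gamma z)⁻¹) z := by
  refine ((differentiableAt_Gamma z hz).hasDerivAt.fun_inv (Gamma_ne_zero hz)).congr_deriv ?_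
  rw [digammaC]
  field_simp

lemma hasDerivAt_inv_Gamma_neg_nat (n : ℕ) :
    HasDerivAt (fun s => (Gamma s)⁻¹) ((-1) ^ n * (n.factorial : ℂ)) (-(n : ℂ)) := by
  have h : (fun s : ℂ => (Gamma s)⁻¹) =
      fun s => (s + n) * (poch s n * (Gamma (s + (n + 1 : ℕ)))⁻¹) := by
    ext s
    rw [inv_Gamma_eq_poch_mul s (n + 1), poch_succ]
    ring
  have hd : Differentiable ℂ fun s : ℂ => poch s n * (Gamma (s + (n + 1 : ℕ)))⁻¹ :=
    (differentiable_poch n).mul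
      (differentiable_one_div_Gamma.comp (differentiable_id.add_const _))
  rw [h]
  refine (((hasDerivAt_id (-(n : ℂ))).add_const (n : ℂ)).fun_mul
    (hd _).hasDerivAt).congr_deriv ?_
  have h1 : -(n : ℂ) + ((n + 1 : ℕ) : ℂ) = 1 := by push_cast; ring
  simp only [id, neg_add_cancel, zero_mul, add_zero, one_mul, h1, Gamma_one,
    inv_one, mul_one, poch_neg_nat_self]

lemma norm_poch_le {N : ℕ} (hN : 1 ≤ N) {a : ℂ} (ha : ‖a‖ ≤ N) (k : ℕ) :
    ‖poch a k‖ ≤ (N : ℝ) ^ k * k.factorial := by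
  induction k with
  | zero => simp [poch]
  | succ k ih =>
    have hN' : (1 : ℝ) ≤ N := mod_cast hN
    have h : ‖a + k‖ ≤ N * (k + 1) := by
      calc ‖a + k‖ ≤ ‖a‖ + ‖(k : ℂ)‖ := norm_add_le _ _
        _ ≤ N + k := by rw [Complex.norm_natCast]; gcongr
        _ ≤ N * (k + 1) := by nlinarith [(k.cast_nonneg : (0 : ℝ) ≤ k)]
    rw [poch_succ, norm_mul, Nat.factorial_succ]
    push_cast
    calc ‖poch a k‖ * ‖a + k‖ ≤ ((N : ℝ) ^ k * k.factorial) * (N * (k + 1)) := by gcongr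
      _ = _ := by ring

lemma exists_norm_inv_Gamma_add_nat_le (N : ℕ) :
    ∃ C : ℝ, ∀ z : ℂ, ‖z‖ ≤ N → ∀ k : ℕ,
      ‖(Gamma (z + k))⁻¹‖ ≤ C * ((N + 2 : ℝ) ^ k / k.factorial) := by
  obtain ⟨B, hB⟩ := (isCompact_closedBall (0 : ℂ) (2 * N + 1)).exists_bound_of_continuousOn
    differentiable_one_div_Gamma.continuous.continuousOn
  have hB0 : 0 ≤ B := (norm_nonneg _).trans (hB 0 (by simp; positivity))
  refine ⟨B * (N + 1).factorial, fun z hz k => ?_⟩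
  have hsmall : ∀ k ≤ N + 1, ‖(Gamma (z + k))⁻¹‖ ≤
      B * (N + 1).factorial * ((N + 2 : ℝ) ^ k / k.factorial) := by
    intro k hk
    have h1 : ‖(Gamma (z + k))⁻¹‖ ≤ B := by
      refine hB _ (mem_closedBall_zero_iff.mpr ((norm_add_le _ _).trans ?_))
      have : (k : ℝ) ≤ N + 1 := mod_cast hk
      rw [Complex.norm_natCast]
      linarith
    have h2 : (1 : ℝ) ≤ (N + 1).factorial / k.factorial := by
      rw [one_le_div (by positivity)]
      exact mod_cast Nat.factorial_le hk
    have h3 : (1 : ℝ) ≤ (N + 2 : ℝ) ^ k := one_le_pow₀ (by linarith [(N.cast_nonneg : (0 : ℝ) ≤ N)])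
    calc _ ≤ B * 1 := by simpa using h1
      _ ≤ B * ((N + 1).factorial / k.factorial * (N + 2 : ℝ) ^ k) := by
        gcongr; exact one_le_mul_of_one_le_of_one_le h2 h3
      _ = _ := by ring
  rcases le_total k (N + 1) with hk | hk
  · exact hsmall k hk
  · induction k, hk using Nat.le_induction with
    | base => exact hsmall _ le_rfl
    | succ k hk ih =>
      have hk' : (N + 1 : ℝ) ≤ k := mod_cast hk
      have h1 : (k + 1 : ℝ) / (N + 2) ≤ ‖z + k‖ := by
        have : ‖(k : ℂ)‖ - ‖z‖ ≤ ‖z + k‖ := by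
          rw [add_comm]; exact norm_sub_le_norm_add _ _
        rw [Complex.norm_natCast] at this
        refine le_trans ?_ this
        rw [div_le_iff₀ (by positivity)]
        nlinarith [(N.cast_nonneg : (0 : ℝ) ≤ N)]
      have h2 : ‖(Gamma (z + (k + 1 : ℕ)))⁻¹‖ * ((k + 1 : ℝ) / (N + 2)) ≤ ‖(Gamma (z + k))⁻¹‖ := by
        rw [one_div_Gamma_eq_self_mul_one_div_Gamma_add_one (z + k), norm_mul, mul_comm,
          add_assoc]
        push_cast
        gcongr
      rw [← le_div_iff₀ (by positivity)] at h2
      refine h2.trans ((div_le_div_of_nonneg_right ih (by positivity)).trans_eq ?_)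
      rw [Nat.factorial_succ k, pow_succ]
      push_cast
      field_simp

lemma exists_summable_norm_regF1_term_le (N : ℕ) (z : ℂ) :
    ∃ u : ℕ → ℝ, Summable u ∧ ∀ a c : ℂ, ‖a‖ ≤ N → ‖c‖ ≤ N → ∀ k : ℕ,
      ‖poch a k * z ^ k / (Gamma (c + k) * k.factorial)‖ ≤ u k := by
  obtain ⟨C, hC⟩ := exists_norm_inv_Gamma_add_nat_le (N + 1)
  refine ⟨fun k => C * (((N + 1 : ℕ) * ‖z‖ * ((N + 1 : ℕ) + 2)) ^ k / k.factorial),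
    (Real.summable_pow_div_factorial _).mul_left C, fun a c ha hc k => ?_⟩
  have hN : (N : ℝ) ≤ (N + 1 : ℕ) := by push_cast; linarith
  have h1 := norm_poch_le (Nat.le_add_left 1 N) (ha.trans hN) k
  have h2 := hC c (hc.trans hN) k
  calc ‖poch a k * z ^ k / (Gamma (c + k) * k.factorial)‖
      = ‖poch a k‖ / k.factorial * ‖z‖ ^ k * ‖(Gamma (c + k))⁻¹‖ := by
        rw [norm_div, norm_mul, norm_mul, norm_pow, Complex.norm_natCast, norm_inv]
        ring
    _ ≤ ((N + 1 : ℕ) : ℝ) ^ k * ‖z‖ ^ k *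
        (C * (((N + 1 : ℕ) + 2 : ℝ) ^ k / k.factorial)) := by
        gcongr
        rw [div_le_iff₀ (by positivity)]
        exact h1
    _ = _ := by
        simp only [mul_pow]
        ring

lemma hasDerivAt_cpow_mul_Gamma_mul_inv_Gamma {z s w v : ℂ} (hz : z ≠ 0)
    (hw : ∀ m : ℕ, w ≠ -m) (hv : ∀ m : ℕ, v ≠ -m) :
    HasDerivAt (fun t => z ^ (s + t) * Gamma (w + t) * (Gamma (v + 2 * t))⁻¹)
      (z ^ s * Gamma w * (Gamma v)⁻¹ * (log z + digammaC w - 2 * digammaC v)) 0 := by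
  have h1 : HasDerivAt (fun t => z ^ (s + t)) (z ^ s * log z) 0 := by
    simpa using ((hasDerivAt_id (0 : ℂ)).const_add s).const_cpow (c := z) (Or.inl hz)
  have h2 : HasDerivAt (fun t => Gamma (w + t)) (Gamma w * digammaC w) 0 := by
    have h := (differentiableAt_Gamma w hw).hasDerivAt
    rw [← add_zero w] at h
    refine (h.comp_const_add w 0).congr_deriv ?_
    rw [digammaC, add_zero, mul_div_cancel₀ _ (Gamma_ne_zero hw)]
  have h3 : HasDerivAt (fun t => (Gamma (v + 2 * t))⁻¹) (-digammaC v * (Gamma v)⁻¹ * 2) 0 := by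
    have h := hasDerivAt_inv_Gamma hv
    have hl : HasDerivAt (fun t : ℂ => v + 2 * t) 2 0 := by
      simpa using ((hasDerivAt_id (0 : ℂ)).const_mul 2).const_add v
    exact h.comp_of_eq 0 hl (by simp)
  refine ((h1.fun_mul h2).fun_mul h3).congr_deriv ?_
  simp only [add_zero, mul_zero]
  ring

/-- The `k`-th term of the power series of `ℐ_{β,μ}(z) e^{z/2} / Γ(1/2-μ-β)`, as a function
of `μ`. -/
noncomputable def whittakerTerm (β z : ℂ) (k : ℕ) (μ : ℂ) : ℂ :=
  z ^ (1 / 2 + μ) * (Gamma (1 / 2 - μ - β))⁻¹ *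
    (poch (1 / 2 + μ - β) k * z ^ k / (Gamma (1 + 2 * μ + k) * k.factorial))

/-- The function `μ ↦ ℐ_{β,μ}(z) e^{z/2} / Γ(1/2-μ-β)`. -/
noncomputable def whittakerSum (β z μ : ℂ) : ℂ := ∑' k, whittakerTerm β z k μ

lemma WI_div_Gamma (β μ z : ℂ) :
    WI β μ z / Gamma (1 / 2 - μ - β) = exp (-z / 2) * whittakerSum β z μ := by
  unfold WI whittakerSum whittakerTerm regF1
  rw [tsum_mul_left]
  ring

lemma WK_eq_whittakerSum (β μ z : ℂ) :
    WK β μ z = -((Real.pi : ℂ) / sin (2 * (Real.pi : ℂ) * μ)) *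
      (exp (-z / 2) * (whittakerSum β z μ - whittakerSum β z (-μ))) := by
  have h := WI_div_Gamma β (-μ) z
  rw [sub_neg_eq_add] at h
  rw [WK, WI_div_Gamma, h, mul_sub (exp _)]

lemma differentiable_whittakerTerm (β : ℂ) {z : ℂ} (hz : z ≠ 0) (k : ℕ) :
    Differentiable ℂ (whittakerTerm β z k) := by
  have h1 : Differentiable ℂ fun μ : ℂ => z ^ (1 / 2 + μ) :=
    (differentiable_id.const_add _).const_cpow (Or.inl hz)
  have h2 : Differentiable ℂ fun μ : ℂ => (Gamma (1 / 2 - μ - β))⁻¹ :=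
    differentiable_one_div_Gamma.comp (by fun_prop : Differentiable ℂ fun μ : ℂ => 1 / 2 - μ - β)
  have h3 : Differentiable ℂ fun μ : ℂ => poch (1 / 2 + μ - β) k :=
    (differentiable_poch k).comp (by fun_prop : Differentiable ℂ fun μ : ℂ => 1 / 2 + μ - β)
  have h4 : Differentiable ℂ fun μ : ℂ => (Gamma (1 + 2 * μ + k))⁻¹ :=
    differentiable_one_div_Gamma.comp (by fun_prop : Differentiable ℂ fun μ : ℂ => 1 + 2 * μ + k)
  unfold whittakerTerm
  simp only [div_eq_mul_inv _ (_ * _), mul_inv]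
  fun_prop

lemma exists_summable_norm_whittakerTerm_le (β : ℂ) {z : ℂ} (hz : z ≠ 0) (R : ℝ) :
    ∃ u : ℕ → ℝ, Summable u ∧
      ∀ k : ℕ, ∀ μ ∈ Metric.ball (0 : ℂ) R, ‖whittakerTerm β z k μ‖ ≤ u k := by
  have hd : Differentiable ℂ fun μ : ℂ => z ^ (1 / 2 + μ) * (Gamma (1 / 2 - μ - β))⁻¹ :=
    ((differentiable_id.const_add _).const_cpow (Or.inl hz)).mul
      (differentiable_one_div_Gamma.comp
        (by fun_prop : Differentiable ℂ fun μ : ℂ => 1 / 2 - μ - β))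
  obtain ⟨B, hB⟩ := (isCompact_closedBall (0 : ℂ) R).exists_bound_of_continuousOn
    hd.continuous.continuousOn
  obtain ⟨N, hN⟩ := exists_nat_ge (1 + 2 * R + ‖β‖)
  obtain ⟨u, hu, hle⟩ := exists_summable_norm_regF1_term_le N z
  refine ⟨fun k => B * u k, hu.mul_left B, fun k μ hμ => ?_⟩
  have hμR : ‖μ‖ ≤ R := (mem_ball_zero_iff.mp hμ).le
  have hB' := hB μ (mem_closedBall_zero_iff.mpr hμR)
  have ha : ‖1 / 2 + μ - β‖ ≤ N := by
    have h1 := norm_sub_le (1 / 2 + μ) β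
    have h2 := norm_add_le (1 / 2) μ
    have h3 : ‖(1 / 2 : ℂ)‖ = 1 / 2 := by norm_num
    linarith [norm_nonneg μ]
  have hc : ‖1 + 2 * μ‖ ≤ N := by
    have h1 := norm_add_le 1 (2 * μ)
    rw [norm_mul, norm_one, Complex.norm_ofNat] at h1
    linarith [norm_nonneg β]
  rw [whittakerTerm, norm_mul]
  exact mul_le_mul hB' (hle _ _ ha hc k) (norm_nonneg _) ((norm_nonneg _).trans hB')

lemma hasSum_whittakerTerm (β : ℂ) {z : ℂ} (hz : z ≠ 0) (μ : ℂ) :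
    HasSum (fun k => whittakerTerm β z k μ) (whittakerSum β z μ) := by
  obtain ⟨u, hu, hle⟩ := exists_summable_norm_whittakerTerm_le β hz (‖μ‖ + 1)
  exact (Summable.of_norm_bounded hu fun k => hle k μ (by simp)).hasSum

lemma differentiableAt_whittakerSum (β : ℂ) {z : ℂ} (hz : z ≠ 0) (μ : ℂ) :
    DifferentiableAt ℂ (whittakerSum β z) μ := by
  obtain ⟨u, hu, hle⟩ := exists_summable_norm_whittakerTerm_le β hz (‖μ‖ + 1)
  exact (differentiableOn_tsum_of_summable_norm hu
    (fun k => (differentiable_whittakerTerm β hz k).differentiableOn) Metric.isOpen_ball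
    hle).differentiableAt (Metric.isOpen_ball.mem_nhds (by simp))

lemma hasSum_deriv_whittakerTerm (β : ℂ) {z : ℂ} (hz : z ≠ 0) (μ : ℂ) :
    HasSum (fun k => deriv (whittakerTerm β z k) μ) (deriv (whittakerSum β z) μ) := by
  obtain ⟨u, hu, hle⟩ := exists_summable_norm_whittakerTerm_le β hz (‖μ‖ + 1)
  exact hasSum_deriv_of_summable_norm hu
    (fun k => (differentiable_whittakerTerm β hz k).differentiableOn) Metric.isOpen_ball
    hle (by simp)

lemma natCast_add_one_ne_neg_natCast (n m : ℕ) : (n : ℂ) + 1 ≠ -(m : ℂ) := by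
  intro h
  have : ((n + 1 + m : ℕ) : ℂ) = 0 := by push_cast; linear_combination h
  rw [Nat.cast_eq_zero] at this
  lia

section HalfInteger

variable {p : ℕ} {β z : ℂ}

lemma whittakerTerm_add_eventuallyEq (hβ : ∀ j : ℕ, (1 + (p : ℂ)) / 2 - β ≠ -(j : ℂ)) (k : ℕ) :
    ∀ᶠ t : ℂ in 𝓝 0, whittakerTerm β z k (p / 2 + t) =
      (Gamma ((1 - p) / 2 - β - t))⁻¹ * (Gamma ((1 + p) / 2 - β + t))⁻¹ *
      (z ^ k / k.factorial * (z ^ ((1 + (p : ℂ)) / 2 + t) * Gamma ((1 + p) / 2 - β + k + t) *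
        (Gamma ((p + k : ℕ) + 1 + 2 * t))⁻¹)) := by
  have hβ' : ∀ m : ℕ, (1 + (p : ℂ)) / 2 - β + k + 0 ≠ -(m : ℂ) := fun m h =>
    hβ (m + k) (by push_cast; linear_combination h)
  have hcont : ContinuousAt (fun t => Gamma ((1 + (p : ℂ)) / 2 - β + k + t)) 0 :=
    (continuousAt_Gamma _ hβ').comp (by fun_prop)
  filter_upwards [hcont.eventually_ne (Gamma_ne_zero hβ')] with t ht
  have e1 : (1 / 2 : ℂ) + (p / 2 + t) = (1 + p) / 2 + t := by ring
  have e2 : (1 / 2 : ℂ) - (p / 2 + t) - β = (1 - p) / 2 - β - t := by ring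
  have e3 : (1 / 2 : ℂ) + (p / 2 + t) - β = (1 + p) / 2 - β + t := by ring
  have e4 : (1 : ℂ) + 2 * (p / 2 + t) + k = (p + k : ℕ) + 1 + 2 * t := by push_cast; ring
  rw [whittakerTerm, e3, e1, e2, e4, poch_eq_Gamma_mul_inv_Gamma (by rwa [add_right_comm]),
    add_right_comm _ t]
  ring

lemma whittakerTerm_neg_add_eventuallyEq (hβ : ∀ j : ℕ, (1 + (p : ℂ)) / 2 - β ≠ -(j : ℂ))
    (k : ℕ) :
    ∀ᶠ t : ℂ in 𝓝 0, whittakerTerm β z (k + p) (-(p / 2 + t)) =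
      (Gamma ((1 - p) / 2 - β - t))⁻¹ * (Gamma ((1 + p) / 2 - β + t))⁻¹ *
      (z ^ (k + p) / (p + k).factorial * (z ^ ((1 - (p : ℂ)) / 2 + -t) *
        Gamma ((1 + p) / 2 - β + k + -t) * (Gamma (k + 1 + 2 * -t))⁻¹)) := by
  have hβ' : ∀ m : ℕ, (1 + (p : ℂ)) / 2 - β + k + -0 ≠ -(m : ℂ) := fun m h =>
    hβ (m + k) (by push_cast; linear_combination h)
  have hcont : ContinuousAt (fun t => Gamma ((1 + (p : ℂ)) / 2 - β + k + -t)) 0 :=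
    ContinuousAt.comp (f := fun t : ℂ => (1 + (p : ℂ)) / 2 - β + k + -t)
      (continuousAt_Gamma _ hβ') (by fun_prop)
  filter_upwards [hcont.eventually_ne (Gamma_ne_zero hβ')] with t ht
  have e1 : (1 / 2 : ℂ) + -(p / 2 + t) = (1 - p) / 2 + -t := by ring
  have e2 : (1 / 2 : ℂ) - -(p / 2 + t) - β = (1 + p) / 2 - β + t := by ring
  have e3 : (1 / 2 : ℂ) + -(p / 2 + t) - β = (1 - p) / 2 - β - t := by ring
  have e4 : (1 : ℂ) + 2 * -(p / 2 + t) + (k + p : ℕ) = k + 1 + 2 * -t := by push_cast; ring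
  have e5 : (1 - (p : ℂ)) / 2 - β - t + (k + p : ℕ) = (1 + p) / 2 - β + k + -t := by
    push_cast; ring
  rw [whittakerTerm, e3, e1, e2, e4, poch_eq_Gamma_mul_inv_Gamma (by rwa [e5]), e5, add_comm p k]
  ring

lemma cpow_mul_pow_eq (hz : z ≠ 0) (s : ℂ) (k : ℕ) : z ^ s * z ^ k = z ^ (s + k) := by
  rw [cpow_add _ _ hz, cpow_natCast]

lemma whittakerTerm_pairing (hβ : ∀ j : ℕ, (1 + (p : ℂ)) / 2 - β ≠ -(j : ℂ)) (hz : z ≠ 0)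
    (k : ℕ) :
    whittakerTerm β z k (p / 2) = whittakerTerm β z (k + p) (-(p / 2)) ∧
    deriv (whittakerTerm β z k) (p / 2) + deriv (whittakerTerm β z (k + p)) (-(p / 2)) =
      2 * (Gamma ((1 - p) / 2 - β))⁻¹ *
        (poch ((1 + p) / 2 - β) k * z ^ ((1 + (p : ℂ)) / 2 + k) /
          ((p + k).factorial * k.factorial) *
          (log z + (digammaC ((1 + p) / 2 - β + k) - digammaC (p + 1 + k) -
            digammaC (1 + k)))) := by
  set a : ℂ := (1 + p) / 2 - β
  set b : ℂ := (1 - p) / 2 - β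
  have hak : ∀ m : ℕ, a + k ≠ -(m : ℂ) := fun m h =>
    hβ (m + k) (by push_cast; linear_combination h)
  set E : ℂ → ℂ := fun t => (Gamma (b - t))⁻¹ * (Gamma (a + t))⁻¹ with hE
  have hEd : Differentiable ℂ E :=
    (differentiable_one_div_Gamma.comp (by fun_prop : Differentiable ℂ fun t => b - t)).mul
      (differentiable_one_div_Gamma.comp (by fun_prop : Differentiable ℂ fun t => a + t))
  set U : ℂ → ℂ := fun t => z ^ k / k.factorial * (z ^ ((1 + (p : ℂ)) / 2 + t) *
    Gamma (a + k + t) * (Gamma ((p + k : ℕ) + 1 + 2 * t))⁻¹) with hU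
  set V : ℂ → ℂ := fun t => z ^ (k + p) / (p + k).factorial * (z ^ ((1 - (p : ℂ)) / 2 + -t) *
    Gamma (a + k + -t) * (Gamma (k + 1 + 2 * -t))⁻¹) with hV
  set M : ℂ := Gamma (a + k) * z ^ ((1 + (p : ℂ)) / 2 + k) /
    ((p + k).factorial * k.factorial) with hM
  have hzU : z ^ k * z ^ ((1 + (p : ℂ)) / 2) = z ^ ((1 + (p : ℂ)) / 2 + k) := by
    rw [mul_comm, cpow_mul_pow_eq hz]
  have hzV : z ^ (k + p) * z ^ ((1 - (p : ℂ)) / 2) = z ^ ((1 + (p : ℂ)) / 2 + k) := by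
    rw [mul_comm, cpow_mul_pow_eq hz]
    congr 1
    push_cast
    ring
  have hU0 : U 0 = M := by
    simp only [hU, hM, add_zero, mul_zero, Gamma_nat_eq_factorial, ← hzU]
    ring
  have hV0 : V 0 = M := by
    simp only [hV, hM, neg_zero, add_zero, mul_zero, Gamma_nat_eq_factorial, ← hzV]
    ring
  have hUd : HasDerivAt U (M * (log z + digammaC (a + k) - 2 * digammaC (p + 1 + k))) 0 := by
    refine ((hasDerivAt_cpow_mul_Gamma_mul_inv_Gamma (s := (1 + (p : ℂ)) / 2) hz hak
      (natCast_add_one_ne_neg_natCast (p + k))).const_mul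
        (z ^ k / (k.factorial : ℂ))).congr_deriv ?_
    rw [Gamma_nat_eq_factorial, hM, ← hzU]
    push_cast
    rw [add_right_comm (p : ℂ) k]
    ring
  have hVd : HasDerivAt V (-(M * (log z + digammaC (a + k) - 2 * digammaC (1 + k)))) 0 := by
    have h := hasDerivAt_cpow_mul_Gamma_mul_inv_Gamma (s := (1 - (p : ℂ)) / 2) hz hak
      (natCast_add_one_ne_neg_natCast k)
    refine ((h.comp_of_eq 0 (hasDerivAt_neg (0 : ℂ)) neg_zero.symm).const_mul
      (z ^ (k + p) / ((p + k).factorial : ℂ))).congr_deriv ?_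
    rw [Gamma_nat_eq_factorial, hM, ← hzV, add_comm (1 : ℂ) k]
    ring
  have hTU : (fun t => whittakerTerm β z k (p / 2 + t)) =ᶠ[𝓝 0] fun t => E t * U t :=
    whittakerTerm_add_eventuallyEq hβ k
  have hTV : (fun t => whittakerTerm β z (k + p) (-(p / 2 + t))) =ᶠ[𝓝 0] fun t => E t * V t :=
    whittakerTerm_neg_add_eventuallyEq hβ k
  have hEM : E 0 * M = (Gamma b)⁻¹ * (poch a k * z ^ ((1 + (p : ℂ)) / 2 + k) /
      ((p + k).factorial * k.factorial)) := by
    simp only [hE, hM, sub_zero, add_zero, poch_eq_Gamma_mul_inv_Gamma (Gamma_ne_zero hak)]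
    ring
  constructor
  · have h1 := hTU.self_of_nhds
    have h2 := hTV.self_of_nhds
    simp only [add_zero, hU0, hV0] at h1 h2
    rw [h1, h2]
  · have h1 : HasDerivAt (fun t => whittakerTerm β z k (p / 2 + t))
        (deriv (whittakerTerm β z k) (p / 2)) 0 := by
      have h := (differentiable_whittakerTerm β hz k (p / 2)).hasDerivAt
      exact (h.comp_of_eq 0 ((hasDerivAt_id (0 : ℂ)).const_add _) (by simp)).congr_deriv
        (mul_one _)
    have h2 : HasDerivAt (fun t => whittakerTerm β z (k + p) (-(p / 2 + t)))
        (-deriv (whittakerTerm β z (k + p)) (-(p / 2))) 0 := by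
      have h := (differentiable_whittakerTerm β hz (k + p) (-(p / 2))).hasDerivAt
      exact (h.comp_of_eq 0 ((hasDerivAt_id (0 : ℂ)).const_add ((p : ℂ) / 2)).fun_neg
        (by simp)).congr_deriv (mul_neg_one _)
    have h3 := h1.unique ((hEd 0).hasDerivAt.mul hUd |>.congr_of_eventuallyEq hTU)
    have h4 := h2.unique ((hEd 0).hasDerivAt.mul hVd |>.congr_of_eventuallyEq hTV)
    rw [hU0] at h3
    rw [hV0] at h4
    rw [mul_assoc 2, ← mul_assoc (Gamma b)⁻¹, ← hEM]
    linear_combination h3 - h4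

lemma whittakerTerm_neg_half_of_lt (hz : z ≠ 0) {j : ℕ} (hj : j < p) :
    whittakerTerm β z j (-(p / 2)) = 0 ∧
    deriv (whittakerTerm β z j) (-(p / 2)) =
      2 * (-1) ^ (p + 1) * (poch ((1 - p) / 2 - β) j * (-1) ^ j * (p - 1 - j).factorial *
        z ^ ((1 - (p : ℂ)) / 2 + j) / (j.factorial * Gamma ((1 + p) / 2 - β))) := by
  obtain ⟨n, rfl⟩ : ∃ n, p = j + n + 1 := ⟨p - 1 - j, by lia⟩
  set q : ℂ := ((j + n + 1 : ℕ) : ℂ) with hq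
  have hq' : q = j + n + 1 := by rw [hq]; push_cast; ring
  have harg : 1 + 2 * -(q / 2) + j = -(n : ℂ) := by rw [hq']; ring
  set F : ℂ → ℂ := fun μ => z ^ (1 / 2 + μ) * (Gamma (1 / 2 - μ - β))⁻¹ *
    (poch (1 / 2 + μ - β) j * z ^ j / j.factorial) with hF
  have hFT : whittakerTerm β z j = fun μ => F μ * (Gamma (1 + 2 * μ + j))⁻¹ := by
    ext μ
    simp only [hF, whittakerTerm]
    ring
  have hFd : Differentiable ℂ F := by
    have h1 : Differentiable ℂ fun μ : ℂ => z ^ (1 / 2 + μ) :=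
      (differentiable_id.const_add _).const_cpow (Or.inl hz)
    have h2 : Differentiable ℂ fun μ : ℂ => (Gamma (1 / 2 - μ - β))⁻¹ :=
      differentiable_one_div_Gamma.comp
        (by fun_prop : Differentiable ℂ fun μ : ℂ => 1 / 2 - μ - β)
    have h3 : Differentiable ℂ fun μ : ℂ => poch (1 / 2 + μ - β) j :=
      (differentiable_poch j).comp (by fun_prop : Differentiable ℂ fun μ : ℂ => 1 / 2 + μ - β)
    exact (h1.mul h2).mul ((h3.mul_const _).div_const _)
  have hG : HasDerivAt (fun μ : ℂ => (Gamma (1 + 2 * μ + j))⁻¹)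
      ((-1) ^ n * (n.factorial : ℂ) * 2) (-(q / 2)) := by
    have hl : HasDerivAt (fun μ : ℂ => 1 + 2 * μ + j) 2 (-(q / 2)) := by
      simpa using (((hasDerivAt_id (-(q / 2))).const_mul 2).const_add 1).add_const (j : ℂ)
    exact (hasDerivAt_inv_Gamma_neg_nat n).comp_of_eq _ hl harg.symm
  rw [hFT]
  constructor
  · beta_reduce
    rw [harg, Gamma_neg_nat_eq_zero, inv_zero, mul_zero]
  · rw [((hFd _).hasDerivAt.fun_mul hG).deriv, harg, Gamma_neg_nat_eq_zero, inv_zero, mul_zero,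
      zero_add]
    have e1 : (1 / 2 : ℂ) + -(q / 2) = (1 - q) / 2 := by ring
    have e2 : (1 / 2 : ℂ) - -(q / 2) - β = (1 + q) / 2 - β := by ring
    have e3 : j + n + 1 - 1 - j = n := by lia
    have e4 : (-1 : ℂ) ^ (j + n + 1 + 1) * (-1) ^ j = (-1) ^ n := by
      rw [← pow_add, show j + n + 1 + 1 + j = 2 * (j + 1) + n by ring, pow_add, pow_mul]
      simp
    simp only [hF, e1, e2, e3, ← cpow_mul_pow_eq hz, ← e4]
    ring

lemma whittakerSum_neg_half (hβ : ∀ j : ℕ, (1 + (p : ℂ)) / 2 - β ≠ -(j : ℂ)) (hz : z ≠ 0) :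
    whittakerSum β z (-(p / 2)) = whittakerSum β z (p / 2) := by
  have h := (hasSum_nat_add_iff' p).mpr (hasSum_whittakerTerm β hz (-(p / 2)))
  rw [Finset.sum_eq_zero fun j hj => (whittakerTerm_neg_half_of_lt hz (Finset.mem_range.mp hj)).1,
    sub_zero] at h
  simp only [← (whittakerTerm_pairing hβ hz _).1] at h
  exact h.unique (hasSum_whittakerTerm β hz (p / 2))

lemma summable_and_WI_half_eq (β : ℂ) (hz : z ≠ 0) :
    Summable (fun k : ℕ => poch ((1 + p) / 2 - β) k * z ^ ((1 + (p : ℂ)) / 2 + k) /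
      ((p + k).factorial * k.factorial : ℂ)) ∧
    WI β (p / 2) z = exp (-z / 2) * ∑' k : ℕ,
      poch ((1 + p) / 2 - β) k * z ^ ((1 + (p : ℂ)) / 2 + k) /
        ((p + k).factorial * k.factorial : ℂ) := by
  have hterm : ∀ k : ℕ, poch ((1 + p) / 2 - β) k * z ^ ((1 + (p : ℂ)) / 2 + k) /
      ((p + k).factorial * k.factorial : ℂ) = z ^ ((1 / 2 : ℂ) + p / 2) *
      (poch (1 / 2 + p / 2 - β) k * z ^ k /
        (Gamma (1 + 2 * (p / 2) + k) * k.factorial)) := by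
    intro k
    have e1 : (1 : ℂ) + 2 * (p / 2) + k = (p + k : ℕ) + 1 := by push_cast; ring
    rw [e1, Gamma_nat_eq_factorial, ← add_div, ← cpow_mul_pow_eq hz]
    ring
  simp only [hterm]
  constructor
  · obtain ⟨N, hN⟩ := exists_nat_ge (max ‖(1 / 2 : ℂ) + p / 2 - β‖ ‖(1 : ℂ) + 2 * (p / 2)‖)
    obtain ⟨u, hu, hle⟩ := exists_summable_norm_regF1_term_le N z
    exact (Summable.of_norm_bounded hu
      (hle _ _ ((le_max_left _ _).trans hN) ((le_max_right _ _).trans hN))).mul_left _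
  · rw [tsum_mul_left, WI, regF1]
    ring

lemma deriv_whittakerSum_half_add_deriv_neg_half
    (hβ : ∀ j : ℕ, (1 + (p : ℂ)) / 2 - β ≠ -(j : ℂ)) (hz : z ≠ 0) :
    (-1) ^ (p + 1) / 2 * (exp (-z / 2) *
      (deriv (whittakerSum β z) (p / 2) + deriv (whittakerSum β z) (-(p / 2)))) =
    (-1) ^ (p + 1) * log z * WI β (p / 2) z / Gamma ((1 - p) / 2 - β) +
      (-1) ^ (p + 1) * (exp (-z / 2) / Gamma ((1 - p) / 2 - β)) *
        ∑' k : ℕ, poch ((1 + p) / 2 - β) k * z ^ ((1 + (p : ℂ)) / 2 + k) /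
          ((p + k).factorial * k.factorial) *
          (digammaC ((1 + p) / 2 - β + k) - digammaC (p + 1 + k) - digammaC (1 + k)) +
      exp (-z / 2) * ∑ j ∈ Finset.range p,
        poch ((1 - p) / 2 - β) j * (-1) ^ j * (p - 1 - j).factorial *
          z ^ ((1 - (p : ℂ)) / 2 + j) / (j.factorial * Gamma ((1 + p) / 2 - β)) := by
  obtain ⟨hc, hWI⟩ := summable_and_WI_half_eq (p := p) β hz
  set c : ℕ → ℂ := fun k => poch ((1 + p) / 2 - β) k * z ^ ((1 + (p : ℂ)) / 2 + k) /
    ((p + k).factorial * k.factorial)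
  set ψ : ℕ → ℂ := fun k =>
    digammaC ((1 + p) / 2 - β + k) - digammaC (p + 1 + k) - digammaC (1 + k)
  set S : ℂ := ∑ j ∈ Finset.range p, poch ((1 - p) / 2 - β) j * (-1) ^ j *
    (p - 1 - j).factorial * z ^ ((1 - (p : ℂ)) / 2 + j) /
      (j.factorial * Gamma ((1 + p) / 2 - β))
  set D : ℂ := deriv (whittakerSum β z) (p / 2) + deriv (whittakerSum β z) (-(p / 2))
  have hsum : HasSum (fun k => 2 * (Gamma ((1 - p) / 2 - β))⁻¹ * (c k * (log z + ψ k)))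
      (D - 2 * (-1) ^ (p + 1) * S) := by
    have h := (hasSum_deriv_whittakerTerm β hz (p / 2)).add
      ((hasSum_nat_add_iff' p).mpr (hasSum_deriv_whittakerTerm β hz (-(p / 2))))
    rw [Finset.sum_congr rfl fun j hj =>
      (whittakerTerm_neg_half_of_lt hz (Finset.mem_range.mp hj)).2, ← Finset.mul_sum,
      ← add_sub_assoc] at h
    simpa only [(whittakerTerm_pairing hβ hz _).2] using h
  have hsq : ((-1 : ℂ) ^ (p + 1)) * (-1) ^ (p + 1) = 1 := by
    rw [← mul_pow]; simp
  change _ = _ + _ * ∑' k, c k * ψ k + _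
  rw [hWI]
  change _ = _ * (_ * ∑' k, c k) / _ + _ + _
  by_cases hG : Gamma ((1 - p) / 2 - β) = 0
  · have h0 : D - 2 * (-1) ^ (p + 1) * S = 0 := by
      refine hsum.unique ?_
      simp [hG, hasSum_zero]
    rw [hG]
    linear_combination (-1) ^ (p + 1) / 2 * exp (-z / 2) * h0 + exp (-z / 2) * S * hsq
  · have hG' : 2 * (Gamma ((1 - p) / 2 - β))⁻¹ ≠ 0 := mul_ne_zero two_ne_zero (inv_ne_zero hG)
    have h1 : Summable fun k => c k * (log z + ψ k) :=
      (summable_mul_left_iff hG').mp hsum.summable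
    have h2 : ∑' k, c k * ψ k = ∑' k, c k * (log z + ψ k) - (∑' k, c k) * log z := by
      rw [← tsum_mul_right, ← h1.tsum_sub (hc.mul_right _)]
      exact tsum_congr fun k => by ring
    have h3 := hsum.tsum_eq
    rw [tsum_mul_left] at h3
    rw [h2]
    linear_combination -(-1) ^ (p + 1) / 2 * exp (-z / 2) * h3 + exp (-z / 2) * S * hsq

end HalfInteger

lemma tendsto_div_nhdsNE_of_hasDerivAt {f g : ℂ → ℂ} {df dg a : ℂ} (hf : HasDerivAt f df a)
    (hg : HasDerivAt g dg a) (hfa : f a = 0) (hga : g a = 0) (hdg : dg ≠ 0) :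
    Tendsto (fun w => f w / g w) (𝓝[≠] a) (𝓝 (df / dg)) := by
  refine ((hasDerivAt_iff_tendsto_slope.mp hf).div (hasDerivAt_iff_tendsto_slope.mp hg)
    hdg).congr' ?_
  filter_upwards [self_mem_nhdsWithin] with w hw
  have : w - a ≠ 0 := sub_ne_zero.mpr hw
  rw [Pi.div_apply, slope_def_field, slope_def_field, hfa, hga, sub_zero, sub_zero]
  exact div_div_div_cancel_right₀ this _ _

end Whittaker

/-- Degenerate case of `𝒦_{β,m}`: for `p ∈ ℕ`, `(1+p)/2 − β` not a nonpositive
integer and `x > 0`, the limit of `𝒦_{β,μ}(x)` as `μ → p/2` through `2μ ∉ ℤ`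
exists and is given by the explicit logarithmic formula. -/
theorem WK_degenerate_limit (p : ℕ) (β : ℂ)
    (hβ : ∀ j : ℕ, (1 + (p : ℂ)) / 2 - β ≠ -(j : ℂ)) (x : ℝ) (hx : 0 < x) :
    Filter.Tendsto (fun μ : ℂ => WK β μ (x : ℂ))
      (nhdsWithin ((p : ℂ) / 2) {μ : ℂ | ∀ n : ℤ, 2 * μ ≠ (n : ℂ)})
      (nhds
        ((-1 : ℂ) ^ (p + 1) * (Real.log x : ℂ) * WI β ((p : ℂ) / 2) (x : ℂ) /
            Complex.Gamma ((1 - (p : ℂ)) / 2 - β)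
          + (-1 : ℂ) ^ (p + 1) *
            (Complex.exp (-(x : ℂ) / 2) / Complex.Gamma ((1 - (p : ℂ)) / 2 - β)) *
            ∑' k : ℕ,
              poch ((1 + (p : ℂ)) / 2 - β) k *
                  (x : ℂ) ^ ((1 + (p : ℂ)) / 2 + (k : ℂ)) /
                  ((Nat.factorial (p + k) : ℂ) * (Nat.factorial k : ℂ)) *
                (digammaC ((1 + (p : ℂ)) / 2 - β + k) - digammaC ((p : ℂ) + 1 + k) -
                  digammaC (1 + (k : ℂ)))
          + Complex.exp (-(x : ℂ) / 2) *
            ∑ j ∈ Finset.range p,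
              poch ((1 - (p : ℂ)) / 2 - β) j * (-1 : ℂ) ^ j *
                  (Nat.factorial (p - 1 - j) : ℂ) *
                  (x : ℂ) ^ ((1 - (p : ℂ)) / 2 + (j : ℂ)) /
                ((Nat.factorial j : ℂ) * Complex.Gamma ((1 + (p : ℂ)) / 2 - β)))) := by
  have hz : (x : ℂ) ≠ 0 := Complex.ofReal_ne_zero.mpr hx.ne'
  set W := whittakerSum β (x : ℂ) with hW
  have hWd := differentiableAt_whittakerSum β hz
  have hN : HasDerivAt (fun μ => Complex.exp (-(x : ℂ) / 2) * (W μ - W (-μ)))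
      (Complex.exp (-(x : ℂ) / 2) * (deriv W (p / 2) + deriv W (-(p / 2)))) ((p : ℂ) / 2) := by
    refine (((hWd _).hasDerivAt.fun_sub ((hWd _).hasDerivAt.comp _
      (hasDerivAt_neg ((p : ℂ) / 2)))).const_mul _).congr_deriv ?_
    ring
  have hpi : 2 * (Real.pi : ℂ) * ((p : ℂ) / 2) = p * Real.pi := by ring
  have hcos : Complex.cos (p * Real.pi) = (-1) ^ p := by
    exact_mod_cast congrArg Complex.ofReal (Real.cos_nat_mul_pi p)
  have hS : HasDerivAt (fun μ => Complex.sin (2 * (Real.pi : ℂ) * μ))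
      ((-1) ^ p * (2 * Real.pi)) ((p : ℂ) / 2) := by
    refine ((hasDerivAt_id ((p : ℂ) / 2)).const_mul (2 * (Real.pi : ℂ))).csin.congr_deriv ?_
    rw [id, hpi, hcos, mul_one]
  have hpi0 : (Real.pi : ℂ) ≠ 0 := Complex.ofReal_ne_zero.mpr Real.pi_ne_zero
  have hlim := tendsto_div_nhdsNE_of_hasDerivAt hN hS
    (by rw [hW, whittakerSum_neg_half hβ hz, sub_self, mul_zero])
    (by rw [hpi, Complex.sin_nat_mul_pi])
    (mul_ne_zero (pow_ne_zero _ (by norm_num)) (mul_ne_zero two_ne_zero hpi0))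
  have hset : {μ : ℂ | ∀ n : ℤ, 2 * μ ≠ (n : ℂ)} ⊆ {(p : ℂ) / 2}ᶜ := by
    rintro μ hμ rfl
    exact hμ p (by push_cast; ring)
  rw [Complex.ofReal_log hx.le, ← deriv_whittakerSum_half_add_deriv_neg_half hβ hz]
  convert (hlim.mono_left (nhdsWithin_mono _ hset)).const_mul (-(Real.pi : ℂ)) using 1
  · ext μ
    rw [WK_eq_whittakerSum]
    ring
  · congr 1
    have hsq : ((-1 : ℂ) ^ p) * (-1) ^ p = 1 := by rw [← mul_pow]; simp
    field_simp
    rw [pow_succ]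
    linear_combination (-(deriv W (p / 2) + deriv W (-(p / 2)))) * hsq
end
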